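/- arXiv:0906.2101 — 10 statements merged into one kernel-verified Lean document; each statement's English description precedes it below -/
import Mathlib

section
/- For every r ∈ ℝ, the principal value limit lim_{ε→0⁺} (1/π^{3/2}) ∫_{{x ∈ ℝ : |r−x| > ε}} e^{−x²}/(r−x) dx exists and equals (2/π)·daw(r), i.e. the Hilbert transform of the squared ground-state Hermite function h₀² (where h₀(x)² = π^{−1/2} e^{−x²}) equals (2/π) times the Dawson integral. -/
open MeasureTheory Filter Topology

noncomputable section

/-- The Dawson integral `daw(r) = e^{-r²} ∫₀^r e^{x²} dx`. -/
def daw (r : ℝ) : ℝ := Real.exp (-r ^ 2) * ∫ x in (0:ℝ)..r, Real.exp (x ^ 2)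

/-- Completing the square in the exponent `-t² + 2ts`. -/
lemma exp_neg_sq_add_eq (s t : ℝ) :
    Real.exp (-t ^ 2 + 2 * t * s) = Real.exp (s ^ 2) * Real.exp (-1 * (t - s) ^ 2) := by
  rw [← Real.exp_add]; ring_nf

lemma integrable_exp_neg_sq_add (s : ℝ) :
    Integrable fun t : ℝ => Real.exp (-t ^ 2 + 2 * t * s) := by
  simp_rw [exp_neg_sq_add_eq]
  exact ((integrable_exp_neg_mul_sq one_pos).comp_sub_right s).const_mul _

lemma integral_exp_neg_sq_add (s : ℝ) :
    ∫ t : ℝ, Real.exp (-t ^ 2 + 2 * t * s) = √Real.pi * Real.exp (s ^ 2) := by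
  simp_rw [exp_neg_sq_add_eq]
  rw [integral_const_mul, integral_sub_right_eq_self (fun t : ℝ => Real.exp (-1 * t ^ 2)) s,
    integral_gaussian, div_one, mul_comm]

lemma integrable_prod_exp_neg_sq_add (a b : ℝ) :
    Integrable (fun p : ℝ × ℝ => Real.exp (-p.2 ^ 2 + 2 * p.2 * p.1))
      ((volume.restrict (Set.uIoc a b)).prod volume) := by
  rw [integrable_prod_iff (by fun_prop)]
  refine ⟨.of_forall fun s => integrable_exp_neg_sq_add s, ?_⟩
  simp only [Real.norm_eq_abs, Real.abs_exp, integral_exp_neg_sq_add]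
  exact intervalIntegrable_iff.1 (Continuous.intervalIntegrable (by fun_prop) a b)

lemma integrable_intervalIntegral_exp_neg_sq_add (a b : ℝ) :
    Integrable fun t : ℝ => ∫ s in a..b, Real.exp (-t ^ 2 + 2 * t * s) := by
  simp_rw [intervalIntegral.intervalIntegral_eq_integral_uIoc]
  exact (integrable_prod_exp_neg_sq_add a b).integral_prod_right.smul (if a ≤ b then (1 : ℝ) else -1)

lemma integral_intervalIntegral_exp_neg_sq_add (a b : ℝ) :
    ∫ t : ℝ, ∫ s in a..b, Real.exp (-t ^ 2 + 2 * t * s) =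
      √Real.pi * ∫ s in a..b, Real.exp (s ^ 2) := by
  rw [← intervalIntegral.integral_const_mul]
  simp_rw [← integral_exp_neg_sq_add]
  exact (intervalIntegral_integral_swap (integrable_prod_exp_neg_sq_add a b)).symm

/-- The even part of `t ↦ e^{-(r-t)²}/t` as an integral of Gaussians. -/
lemma exp_neg_sub_sq_div_add (r : ℝ) {t : ℝ} (ht : t ≠ 0) :
    Real.exp (-(r - t) ^ 2) / t + Real.exp (-(r - -t) ^ 2) / -t =
      2 * Real.exp (-r ^ 2) * ∫ s in (-r)..r, Real.exp (-t ^ 2 + 2 * t * s) := by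
  have h : ∫ s in (-r)..r, Real.exp (-t ^ 2 + 2 * t * s) =
      (Real.exp (-t ^ 2 + 2 * t * r) - Real.exp (-t ^ 2 + 2 * t * -r)) / (2 * t) := by
    rw [intervalIntegral.integral_comp_add_mul (f := Real.exp) (mul_ne_zero two_ne_zero ht),
      integral_exp, smul_eq_mul, inv_mul_eq_div]
  have h₁ : Real.exp (-(r - t) ^ 2) = Real.exp (-r ^ 2) * Real.exp (-t ^ 2 + 2 * t * r) := by
    rw [← Real.exp_add]; ring_nf
  have h₂ : Real.exp (-(r - -t) ^ 2) = Real.exp (-r ^ 2) * Real.exp (-t ^ 2 + 2 * t * -r) := by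
    rw [← Real.exp_add]; ring_nf
  rw [h, h₁, h₂]
  field_simp
  ring

lemma measurableSet_lt_abs (ε : ℝ) : MeasurableSet {t : ℝ | ε < |t|} :=
  measurableSet_lt measurable_const (by fun_prop)

lemma integrableOn_exp_neg_sub_sq_div (r : ℝ) {ε : ℝ} (hε : 0 < ε) :
    IntegrableOn (fun t : ℝ => Real.exp (-(r - t) ^ 2) / t) {t : ℝ | ε < |t|} := by
  have h : Integrable fun t : ℝ => Real.exp (-(r - t) ^ 2) / ε := by
    have := ((integrable_exp_neg_mul_sq one_pos).comp_sub_left r).div_const ε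
    simpa only [neg_one_mul] using this
  refine h.integrableOn.mono' (Measurable.aestronglyMeasurable (by fun_prop)) ?_
  filter_upwards [ae_restrict_mem (measurableSet_lt_abs ε)] with t ht
  rw [norm_div, Real.norm_eq_abs, Real.abs_exp, Real.norm_eq_abs]
  exact div_le_div_of_nonneg_left (Real.exp_pos _).le hε (le_of_lt ht)

lemma setIntegral_lt_abs_comp_neg (f : ℝ → ℝ) (ε : ℝ) :
    ∫ t in {t : ℝ | ε < |t|}, f (-t) = ∫ t in {t : ℝ | ε < |t|}, f t := by
  simpa using (Measure.measurePreserving_neg (volume : Measure ℝ)).setIntegral_preimage_emb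
    (MeasurableEquiv.neg ℝ).measurableEmbedding f {t : ℝ | ε < |t|}

/-- A truncated integral is half the truncated integral of twice the even part. -/
lemma two_mul_setIntegral_lt_abs {f : ℝ → ℝ} {ε : ℝ} (hf : IntegrableOn f {t : ℝ | ε < |t|}) :
    2 * ∫ t in {t : ℝ | ε < |t|}, f t = ∫ t in {t : ℝ | ε < |t|}, (f t + f (-t)) := by
  have hf' : IntegrableOn (fun t => f (-t)) {t : ℝ | ε < |t|} := by
    have := ((Measure.measurePreserving_neg (volume : Measure ℝ)).integrableOn_comp_preimage
      (MeasurableEquiv.neg ℝ).measurableEmbedding (f := f) (s := {t : ℝ | ε < |t|})).2 hf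
    simpa [Function.comp_def] using this
  rw [integral_add hf hf', setIntegral_lt_abs_comp_neg, two_mul]

lemma tendsto_setIntegral_lt_abs {f : ℝ → ℝ} (hf : Integrable f) :
    Tendsto (fun ε : ℝ => ∫ t in {t : ℝ | ε < |t|}, f t) (𝓝[>] 0) (𝓝 (∫ t, f t)) := by
  simp_rw [← integral_indicator (measurableSet_lt_abs _)]
  refine tendsto_integral_filter_of_dominated_convergence (fun t => ‖f t‖)
    (.of_forall fun ε => hf.aestronglyMeasurable.indicator (measurableSet_lt_abs ε))
    (.of_forall fun ε => .of_forall fun t => norm_indicator_le_norm_self _ _) hf.norm ?_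
  filter_upwards [compl_mem_ae_iff.2 (measure_singleton (0 : ℝ))] with t ht
  refine tendsto_const_nhds.congr' ?_
  filter_upwards [nhdsWithin_le_nhds (Iio_mem_nhds (abs_pos.2 ht))] with ε hε
  exact (Set.indicator_of_mem (show t ∈ {t : ℝ | ε < |t|} from hε) f).symm

lemma integral_exp_sq_symm (r : ℝ) :
    ∫ s in (-r)..r, Real.exp (s ^ 2) = 2 * ∫ s in (0 : ℝ)..r, Real.exp (s ^ 2) := by
  have hc (a b : ℝ) : IntervalIntegrable (fun s : ℝ => Real.exp (s ^ 2)) volume a b :=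
    Continuous.intervalIntegrable (by fun_prop) a b
  rw [← intervalIntegral.integral_add_adjacent_intervals (hc (-r) 0) (hc 0 r), two_mul]
  congr 1
  have h := intervalIntegral.integral_comp_neg (a := 0) (b := r) fun s : ℝ => Real.exp (s ^ 2)
  simp only [neg_sq, neg_zero] at h
  exact h.symm

lemma setIntegral_lt_abs_sub_left (f : ℝ → ℝ) (r ε : ℝ) :
    ∫ x in {x : ℝ | ε < |r - x|}, f (r - x) = ∫ t in {t : ℝ | ε < |t|}, f t :=
  (Measure.measurePreserving_sub_left (volume : Measure ℝ) r).setIntegral_preimage_emb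
    (MeasurableEquiv.subLeft r).measurableEmbedding f {t : ℝ | ε < |t|}

lemma setIntegral_exp_neg_sq_div_sub (r : ℝ) {ε : ℝ} (hε : 0 < ε) :
    ∫ x in {x : ℝ | ε < |r - x|}, Real.exp (-x ^ 2) / (r - x) =
      Real.exp (-r ^ 2) *
        ∫ t in {t : ℝ | ε < |t|}, ∫ s in (-r)..r, Real.exp (-t ^ 2 + 2 * t * s) := by
  have h := setIntegral_lt_abs_sub_left (fun t => Real.exp (-(r - t) ^ 2) / t) r ε
  simp only [sub_sub_cancel] at h
  have h₂ := two_mul_setIntegral_lt_abs (integrableOn_exp_neg_sub_sq_div r hε)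
  rw [setIntegral_congr_fun (measurableSet_lt_abs ε) fun t ht =>
    exp_neg_sub_sq_div_add r (abs_pos.1 (hε.trans ht)), integral_const_mul] at h₂
  rw [h]
  linarith

/-- The principal value limit
`lim_{ε→0⁺} (1/π^{3/2}) ∫_{|r-x|>ε} e^{-x²}/(r-x) dx` exists and equals `(2/π)·daw(r)`,
i.e. the Hilbert transform of `h₀²` (with `h₀(x)² = π^{-1/2} e^{-x²}`) is `(2/π)·daw`. -/
theorem hilbert_transform_h0_sq (r : ℝ) :
    Tendsto
      (fun ε : ℝ =>
        (1 / (Real.pi * Real.sqrt Real.pi)) *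
          ∫ x in {x : ℝ | ε < |r - x|}, Real.exp (-x ^ 2) / (r - x))
      (𝓝[>] (0:ℝ)) (𝓝 ((2 / Real.pi) * daw r)) := by
  have h := ((tendsto_setIntegral_lt_abs (integrable_intervalIntegral_exp_neg_sq_add (-r) r)
    ).const_mul (Real.exp (-r ^ 2))).const_mul (1 / (Real.pi * √Real.pi))
  rw [integral_intervalIntegral_exp_neg_sq_add, integral_exp_sq_symm] at h
  have heq : 2 / Real.pi * daw r = 1 / (Real.pi * √Real.pi) * (Real.exp (-r ^ 2) *
      (√Real.pi * (2 * ∫ s in (0 : ℝ)..r, Real.exp (s ^ 2)))) := by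
    have := (Real.sqrt_pos.2 Real.pi_pos).ne'
    rw [daw]
    field_simp
  rw [heq]
  refine h.congr' ?_
  filter_upwards [self_mem_nhdsWithin] with ε hε
  rw [setIntegral_exp_neg_sq_div_sub r hε]

end
end

section
/- For every r ∈ ℝ, the principal value limit lim_{ε→0⁺} ∫_{{x ∈ ℝ : |r−x| > ε}} (−2x e^{−x²})/(r−x) dx exists and equals 2√π − 2r · lim_{ε→0⁺} ∫_{{x ∈ ℝ : |r−x| > ε}} e^{−x²}/(r−x) dx (both limits existing). -/
open MeasureTheory Filter Topology

noncomputable section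

lemma measurableSet_lt_abs_sub (r ε : ℝ) : MeasurableSet {x : ℝ | ε < |r - x|} :=
  measurableSet_lt (by fun_prop) (by fun_prop)

/-- Truncated integrals of an integrable function converge to the full integral. -/
lemma tendsto_setIntegral_lt_abs_sub {g : ℝ → ℝ} (hg : Integrable g) (r : ℝ) :
    Tendsto (fun ε : ℝ => ∫ x in {x : ℝ | ε < |r - x|}, g x) (𝓝[>] (0:ℝ)) (𝓝 (∫ x, g x)) := by
  simp_rw [← integral_indicator (measurableSet_lt_abs_sub r _)]
  refine tendsto_integral_filter_of_dominated_convergence (fun x => ‖g x‖) ?_ ?_ hg.norm ?_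
  · exact .of_forall fun ε =>
      (hg.indicator (measurableSet_lt_abs_sub r ε)).aestronglyMeasurable
  · exact .of_forall fun ε => .of_forall fun x => norm_indicator_le_norm_self _ _
  · filter_upwards [compl_mem_ae_iff.mpr (measure_singleton (μ := volume) r)] with x hx
    have hpos : 0 < |r - x| := abs_pos.mpr (sub_ne_zero.mpr fun h => hx h.symm)
    refine tendsto_const_nhds.congr' ?_
    filter_upwards [mem_nhdsWithin_of_mem_nhds (Iio_mem_nhds hpos)] with ε hε
    exact (Set.indicator_of_mem (s := {x : ℝ | ε < |r - x|}) hε g).symm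

lemma integrableOn_div_sub {f : ℝ → ℝ} (hf : Integrable f) (r : ℝ) {ε : ℝ} (hε : 0 < ε) :
    IntegrableOn (fun x => f x / (r - x)) {x : ℝ | ε < |r - x|} := by
  refine ((hf.norm.div_const ε).integrableOn).mono' ?_ ?_
  · exact (hf.aestronglyMeasurable.aemeasurable.div
      (by fun_prop)).aestronglyMeasurable.restrict
  · filter_upwards [ae_restrict_mem (measurableSet_lt_abs_sub r ε)] with x hx
    rw [norm_div, Real.norm_eq_abs (r - x)]
    have : ε < |r - x| := hx
    gcongr

/-- The truncated integral is invariant under the reflection about `r`. -/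
lemma setIntegral_lt_abs_sub_reflect (h : ℝ → ℝ) (r ε : ℝ) :
    ∫ x in {x : ℝ | ε < |r - x|}, h (2 * r - x) = ∫ x in {x : ℝ | ε < |r - x|}, h x := by
  rw [← integral_indicator (measurableSet_lt_abs_sub r ε),
    ← integral_indicator (measurableSet_lt_abs_sub r ε),
    ← integral_sub_left_eq_self _ volume (2 * r)]
  congr 1 with x
  have : |r - (2 * r - x)| = |r - x| := by rw [← abs_neg]; ring_nf
  simp [Set.indicator_apply, this]

lemma integrable_sub_reflect_div_sub {f : ℝ → ℝ} {K : NNReal} (hf : Integrable f)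
    (hK : LipschitzWith K f) (r : ℝ) :
    Integrable (fun x => (f x - f (2 * r - x)) / (r - x)) := by
  have hf' : Integrable fun x => f (2 * r - x) := hf.comp_sub_left (2 * r)
  have hc : Integrable ((Metric.closedBall r 1).indicator fun _ : ℝ => 2 * (K : ℝ)) :=
    (integrable_indicator_iff Metric.isClosed_closedBall.measurableSet).mpr
      (integrableOn_const (isCompact_closedBall r 1).measure_lt_top.ne)
  refine (hc.add (hf.norm.add hf'.norm)).mono' ?_ (.of_forall fun x => ?_)
  · exact ((hf.sub hf').aestronglyMeasurable.aemeasurable.div (by fun_prop)).aestronglyMeasurable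
  · simp only [Pi.add_apply, norm_div]
    by_cases hx : x ∈ Metric.closedBall r 1
    · rw [Set.indicator_of_mem hx]
      have h1 : ‖f x - f (2 * r - x)‖ ≤ 2 * K * ‖r - x‖ := by
        refine (hK.norm_sub_le x (2 * r - x)).trans_eq ?_
        rw [show x - (2 * r - x) = -2 * (r - x) by ring, norm_mul]
        norm_num
        ring
      have h2 := div_le_of_le_mul₀ (norm_nonneg (r - x)) (by positivity) h1
      linarith [norm_nonneg (f x), norm_nonneg (f (2 * r - x))]
    · rw [Set.indicator_of_notMem hx, zero_add]
      have h1 : 1 ≤ ‖r - x‖ := by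
        rw [Metric.mem_closedBall, not_le, dist_comm, dist_eq_norm] at hx
        exact hx.le
      exact (div_le_self (norm_nonneg _) h1).trans (norm_sub_le _ _)

/-- The principal value integral of an integrable Lipschitz function against `1 / (r - x)`. -/
lemma tendsto_setIntegral_div_sub {f : ℝ → ℝ} {K : NNReal} (hf : Integrable f)
    (hK : LipschitzWith K f) (r : ℝ) :
    Tendsto (fun ε : ℝ => ∫ x in {x : ℝ | ε < |r - x|}, f x / (r - x)) (𝓝[>] (0:ℝ))
      (𝓝 ((∫ x, (f x - f (2 * r - x)) / (r - x)) / 2)) := by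
  refine ((tendsto_setIntegral_lt_abs_sub
    (integrable_sub_reflect_div_sub hf hK r) r).div_const 2).congr' ?_
  filter_upwards [self_mem_nhdsWithin] with ε hε
  have hrefl := setIntegral_lt_abs_sub_reflect (fun x => f x / (r - x)) r ε
  have hneg : ∀ x, f (2 * r - x) / (r - (2 * r - x)) = -(f (2 * r - x) / (r - x)) := fun x => by
    rw [← div_neg]; ring_nf
  simp only [hneg, integral_neg] at hrefl
  simp_rw [sub_div]
  rw [integral_sub (integrableOn_div_sub hf r hε)
    (integrableOn_div_sub (hf.comp_sub_left (2 * r)) r hε)]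
  linarith

lemma lipschitzWith_exp_neg_sq : LipschitzWith 1 fun x : ℝ => Real.exp (-x ^ 2) := by
  have hd (x : ℝ) : HasDerivAt (fun x : ℝ => Real.exp (-x ^ 2))
      (Real.exp (-x ^ 2) * -(2 * x)) x := by
    simpa using ((hasDerivAt_pow 2 x).neg).exp
  refine lipschitzWith_of_nnnorm_deriv_le (fun x => (hd x).differentiableAt) fun x => ?_
  rw [(hd x).deriv, ← NNReal.coe_le_coe, coe_nnnorm, norm_mul, Real.norm_eq_abs, Real.abs_exp,
    Real.exp_neg, inv_mul_le_iff₀ (Real.exp_pos _), norm_neg, Real.norm_eq_abs, abs_mul, abs_two,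
    NNReal.coe_one, mul_one]
  nlinarith [Real.add_one_le_exp (x ^ 2), sq_nonneg (|x| - 1), sq_abs x]

/-- For every `r ∈ ℝ`, the principal value limit
`lim_{ε→0⁺} ∫_{|r-x|>ε} (-2x e^{-x²})/(r-x) dx` exists and equals
`2√π - 2r · lim_{ε→0⁺} ∫_{|r-x|>ε} e^{-x²}/(r-x) dx`, both limits existing. -/
theorem pv_deriv_gaussian (r : ℝ) :
    ∃ L : ℝ,
      Tendsto (fun ε : ℝ => ∫ x in {x : ℝ | ε < |r - x|}, Real.exp (-x ^ 2) / (r - x))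
        (𝓝[>] (0:ℝ)) (𝓝 L) ∧
      Tendsto (fun ε : ℝ => ∫ x in {x : ℝ | ε < |r - x|}, (-2 * x * Real.exp (-x ^ 2)) / (r - x))
        (𝓝[>] (0:ℝ)) (𝓝 (2 * Real.sqrt Real.pi - 2 * r * L)) := by
  have hint : Integrable fun x : ℝ => Real.exp (-x ^ 2) := by
    simpa using integrable_exp_neg_mul_sq one_pos
  have hgauss : ∫ x : ℝ, Real.exp (-x ^ 2) = Real.sqrt Real.pi := by
    simpa using integral_gaussian 1
  have hL := tendsto_setIntegral_div_sub hint lipschitzWith_exp_neg_sq r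
  refine ⟨_, hL, ?_⟩
  have hlim := tendsto_setIntegral_lt_abs_sub hint r
  rw [hgauss] at hlim
  refine ((hlim.const_mul 2).sub (hL.const_mul (2 * r))).congr' ?_
  filter_upwards [self_mem_nhdsWithin] with ε hε
  rw [← integral_const_mul, ← integral_const_mul,
    ← integral_sub (hint.integrableOn.const_mul 2)
      ((integrableOn_div_sub hint r hε).const_mul (2 * r))]
  refine setIntegral_congr_fun (measurableSet_lt_abs_sub r ε) fun x hx => ?_
  have hne : r - x ≠ 0 := abs_pos.mp (lt_trans hε hx)
  field_simp
  ring

end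
end

section
/- For all r, θ ∈ ℝ, Y(r) − (1/√2)·Y′(r)·cos θ + (1/4)·Y″(r) = 2(r + √2·cos θ)·(r + (1 − 2r²)·daw(r)). (This is the density of the generalized Markov kernel for the Schrödinger cat kernel state ψ = (|0⟩+|1⟩)/√2.) -/
open MeasureTheory Filter Topology

noncomputable section

/-- `Y(r) := 2·daw'(r) = 2(1 - 2r·daw(r))`. -/
def Yf (r : ℝ) : ℝ := 2 * (1 - 2 * r * daw r)

theorem hasDerivAt_daw (r : ℝ) : HasDerivAt daw (1 - 2 * r * daw r) r := by
  have hcont : Continuous fun x : ℝ => Real.exp (x ^ 2) := by fun_prop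
  have hint : HasDerivAt (fun u : ℝ => ∫ x in (0:ℝ)..u, Real.exp (x ^ 2)) (Real.exp (r ^ 2)) r :=
    intervalIntegral.integral_hasDerivAt_right (hcont.intervalIntegrable 0 r)
      (hcont.stronglyMeasurableAtFilter _ _) hcont.continuousAt
  have hexp : HasDerivAt (fun u : ℝ => Real.exp (-u ^ 2)) (Real.exp (-r ^ 2) * (-(2 * r))) r := by
    simpa using ((hasDerivAt_pow 2 r).neg).exp
  refine (hexp.mul hint).congr_deriv ?_
  have hone : Real.exp (-r ^ 2) * Real.exp (r ^ 2) = 1 := by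
    rw [← Real.exp_add, neg_add_cancel, Real.exp_zero]
  rw [hone, daw]
  ring

theorem hasDerivAt_Yf (r : ℝ) :
    HasDerivAt Yf (-4 * (r + (1 - 2 * r ^ 2) * daw r)) r := by
  refine (((((hasDerivAt_id r).const_mul 2).mul (hasDerivAt_daw r)).const_sub 1).const_mul
    2).congr_deriv ?_
  simp only [id]
  ring

theorem deriv_Yf : deriv Yf = fun r => -4 * (r + (1 - 2 * r ^ 2) * daw r) :=
  funext fun r => (hasDerivAt_Yf r).deriv

theorem hasDerivAt_deriv_Yf (r : ℝ) :
    HasDerivAt (deriv Yf) (-4 * (2 - 2 * r ^ 2 - 6 * r * daw r + 4 * r ^ 3 * daw r)) r := by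
  rw [deriv_Yf]
  refine (((hasDerivAt_id r).add (((((hasDerivAt_pow 2 r).const_mul 2).const_sub 1).mul
    (hasDerivAt_daw r)))).const_mul (-4)).congr_deriv ?_
  norm_num
  ring

/-- The density of the generalized Markov kernel for the Schrödinger cat state
`ψ = (|0⟩+|1⟩)/√2`:
`Y(r) - (1/√2)Y'(r)cos θ + (1/4)Y''(r) = 2(r + √2 cos θ)(r + (1-2r²)daw(r))`. -/
theorem cat_state_kernel_density (r θ : ℝ) :
    Yf r - (1 / Real.sqrt 2) * deriv Yf r * Real.cos θ + (1 / 4) * deriv (deriv Yf) r =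
      2 * (r + Real.sqrt 2 * Real.cos θ) * (r + (1 - 2 * r ^ 2) * daw r) := by
  have hsq : Real.sqrt 2 * Real.sqrt 2 = 2 := Real.mul_self_sqrt (by norm_num)
  have hinv : 1 / Real.sqrt 2 = Real.sqrt 2 / 2 := by
    rw [div_eq_div_iff (by positivity) (by norm_num), hsq, one_mul]
  rw [(hasDerivAt_deriv_Yf r).deriv, deriv_Yf, hinv, Yf]
  ring

end
end

section
/- For every λ ∈ (−1,1) and every r ∈ ℝ, the iterated series (1−λ)·Σ_{n=0}^∞ λ^n · [((−1)^n/n!)·Σ_{k=n}^∞ [(−1)^k/(2^k (2k)!)]·[(k!)²/(k−n)!]·H_{2k}(r)] converges and equals (1−λ)·Σ_{k=0}^∞ [(λ−1)^k k!/(2^k (2k)!)]·H_{2k}(r); here the inner bracket is the density M^{nn}(r) of the generalized Markov kernel of |n⟩⟨n|. -/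
open MeasureTheory Filter Topology

noncomputable section

/-- The physicists' Hermite polynomials:
`H₀ = 1`, `H₁(x) = 2x`, `H_{n+1}(x) = 2x·H_n(x) - 2n·H_{n-1}(x)`. -/
def hermiteH : ℕ → ℝ → ℝ
  | 0 => fun _ => 1
  | 1 => fun x => 2 * x
  | (n + 2) => fun x => 2 * x * hermiteH (n + 1) x - 2 * (n + 1) * hermiteH n x

/-- The even Hermite polynomials, scaled so as to grow subexponentially in the index. -/
def scaledEven (x : ℝ) (k : ℕ) : ℝ :=
  (-1) ^ k * (k.factorial : ℝ) / ((2 * k).factorial : ℝ) * hermiteH (2 * k) x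

/-- The odd Hermite polynomials, scaled so as to grow subexponentially in the index. -/
def scaledOdd (x : ℝ) (k : ℕ) : ℝ :=
  (-1) ^ k * (k.factorial : ℝ) / ((2 * k + 1).factorial : ℝ) * hermiteH (2 * k + 1) x

lemma scaledEven_succ (x : ℝ) (k : ℕ) :
    scaledEven x (k + 1) = scaledEven x k - x * scaledOdd x k := by
  have e : hermiteH (2 * (k + 1)) x =
      2 * x * hermiteH (2 * k + 1) x - 2 * ((2 * k : ℕ) + 1) * hermiteH (2 * k) x := rfl
  have f1 : ((2 * (k + 1)).factorial : ℝ) =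
      (2 * k + 2) * ((2 * k + 1) * ((2 * k).factorial : ℝ)) := by
    rw [show 2 * (k + 1) = 2 * k + 1 + 1 by ring, Nat.factorial_succ, Nat.factorial_succ]
    push_cast; ring
  have f2 : ((2 * k + 1).factorial : ℝ) = (2 * k + 1) * ((2 * k).factorial : ℝ) := by
    rw [Nat.factorial_succ]; push_cast; ring
  have := Nat.factorial_ne_zero (2 * k)
  unfold scaledEven scaledOdd
  rw [e, f1, f2, Nat.factorial_succ]
  push_cast
  field_simp
  ring

lemma scaledOdd_succ (x : ℝ) (k : ℕ) :
    scaledOdd x (k + 1) = (2 * k + 2) / (2 * k + 3) * scaledOdd x k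
      + 2 * x / (2 * k + 3) * scaledEven x (k + 1) := by
  have e : hermiteH (2 * (k + 1) + 1) x = 2 * x * hermiteH (2 * (k + 1)) x
      - 2 * ((2 * k + 1 : ℕ) + 1) * hermiteH (2 * k + 1) x := rfl
  have f0 : ((2 * (k + 1) + 1).factorial : ℝ) =
      (2 * k + 3) * ((2 * k + 2) * ((2 * k + 1).factorial : ℝ)) := by
    rw [show 2 * (k + 1) + 1 = 2 * k + 1 + 1 + 1 by ring, Nat.factorial_succ, Nat.factorial_succ]
    push_cast; ring
  have f1 : ((2 * (k + 1)).factorial : ℝ) = (2 * k + 2) * ((2 * k + 1).factorial : ℝ) := by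
    rw [show 2 * (k + 1) = 2 * k + 1 + 1 by ring, Nat.factorial_succ]
    push_cast; ring
  have := Nat.factorial_ne_zero (2 * k + 1)
  unfold scaledEven scaledOdd
  rw [e, f0, f1, Nat.factorial_succ]
  push_cast
  field_simp
  ring

lemma abs_scaledOdd_succ_le (x : ℝ) (k : ℕ) :
    |scaledOdd x (k + 1)| ≤ |scaledOdd x k| + 2 * |x| / (2 * k + 3) * |scaledEven x (k + 1)| := by
  have h3 : (0 : ℝ) < 2 * k + 3 := by positivity
  have h1 : (2 * k + 2 : ℝ) / (2 * k + 3) ≤ 1 := by rw [div_le_one h3]; linarith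
  rw [scaledOdd_succ]
  refine (abs_add_le _ _).trans ?_
  rw [abs_mul, abs_mul, abs_div, abs_div, abs_mul, abs_of_pos h3, abs_two,
    abs_of_pos (by positivity : (0 : ℝ) < 2 * k + 2)]
  gcongr
  exact mul_le_of_le_one_left (abs_nonneg _) h1

lemma summable_abs_scaledEven_mul_pow (x : ℝ) {q : ℝ} (hq0 : 0 ≤ q) (hq1 : q < 1) :
    Summable fun k => |scaledEven x k| * q ^ k := by
  obtain ⟨δ, hδ, hδq⟩ : ∃ δ : ℝ, 0 < δ ∧ (1 + δ) ^ 2 * q < 1 := by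
    have hc : ContinuousAt (fun δ : ℝ => (1 + δ) ^ 2 * q) 0 := by fun_prop
    have hev : ∀ᶠ δ : ℝ in 𝓝[>] 0, (1 + δ) ^ 2 * q < 1 :=
      (hc.eventually_lt continuousAt_const (by simpa using hq1)).filter_mono nhdsWithin_le_nhds
    exact (eventually_mem_nhdsWithin.and hev).exists
  set w := |x| / δ with hw
  have hw0 : 0 ≤ w := by positivity
  have hxw : |x| = δ * w := by rw [hw]; field_simp
  have hlim : Tendsto (fun k : ℕ => w * (2 * |x| / (2 * k + 3))) atTop (𝓝 0) := by
    have : Tendsto (fun k : ℕ => (2 * k + 3 : ℝ)) atTop atTop :=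
      tendsto_atTop_add_const_right _ _
        (tendsto_natCast_atTop_atTop.const_mul_atTop (by norm_num))
    simpa using (this.const_div_atTop (2 * |x|)).const_mul w
  have hsum : Summable fun k => (|scaledEven x k| + w * |scaledOdd x k|) * q ^ k := by
    refine summable_of_ratio_norm_eventually_le hδq ?_
    filter_upwards [hlim.eventually_le_const hδ] with k hk
    rw [Real.norm_of_nonneg (by positivity), Real.norm_of_nonneg (by positivity)]
    have hA : |scaledEven x (k + 1)| ≤ |scaledEven x k| + δ * w * |scaledOdd x k| := by
      rw [scaledEven_succ, ← hxw, ← abs_mul]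
      exact abs_sub _ _
    have hB : |scaledEven x (k + 1)| + w * |scaledOdd x (k + 1)| ≤
        (1 + δ) ^ 2 * (|scaledEven x k| + w * |scaledOdd x k|) := by
      calc _ ≤ |scaledEven x (k + 1)| + w * (|scaledOdd x k|
              + 2 * |x| / (2 * k + 3) * |scaledEven x (k + 1)|) := by
            gcongr; exact abs_scaledOdd_succ_le x k
        _ = (1 + w * (2 * |x| / (2 * k + 3))) * |scaledEven x (k + 1)|
              + w * |scaledOdd x k| := by ring
        _ ≤ (1 + δ) * (|scaledEven x k| + δ * w * |scaledOdd x k|) + w * |scaledOdd x k| := by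
            gcongr
        _ ≤ _ := by
            have : 0 ≤ w * |scaledOdd x k| := by positivity
            have := abs_nonneg (scaledEven x k)
            nlinarith [mul_nonneg hδ.le this, mul_nonneg (sq_nonneg δ) this,
              mul_nonneg hδ.le ‹0 ≤ w * |scaledOdd x k|›]
    calc _ ≤ (1 + δ) ^ 2 * (|scaledEven x k| + w * |scaledOdd x k|) * q ^ (k + 1) := by gcongr
      _ = _ := by ring
  refine hsum.of_nonneg_of_le (fun k => by positivity) fun k => ?_
  gcongr
  exact le_add_of_nonneg_right (by positivity)

lemma sum_antidiagonal_pow_mul_choose (c : ℕ → ℝ) (z : ℝ) (k : ℕ) :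
    ∑ p ∈ Finset.HasAntidiagonal.antidiagonal k, z ^ p.1 * ((p.1 + p.2).choose p.1 * c (p.1 + p.2)) =
      c k * (1 + z) ^ k := by
  rw [add_comm 1 z, (Commute.all z 1).add_pow', Finset.mul_sum]
  refine Finset.sum_congr rfl fun p hp => ?_
  rw [Finset.HasAntidiagonal.mem_antidiagonal.mp hp]
  simp only [one_pow, nsmul_eq_mul]
  ring

/-- Expanding `(1 + z) ^ k` in `∑ c k * (1 + z) ^ k` and exchanging the order of summation. -/
lemma hasSum_prod_pow_mul_choose {c : ℕ → ℝ} {z : ℝ}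
    (h : Summable fun k => |c k| * (1 + |z|) ^ k) :
    HasSum (fun p : ℕ × ℕ => z ^ p.1 * ((p.1 + p.2).choose p.1 * c (p.1 + p.2)))
      (∑' k, c k * (1 + z) ^ k) := by
  have hs : Summable fun p : ℕ × ℕ => z ^ p.1 * ((p.1 + p.2).choose p.1 * c (p.1 + p.2)) := by
    rw [← summable_norm_iff, ← (Finset.HasAntidiagonal.sigmaAntidiagonalEquivProd (A := ℕ)).summable_iff]
    refine (summable_sigma_of_nonneg fun _ => norm_nonneg _).mpr
      ⟨fun k => (hasSum_fintype _).summable, h.congr fun k => ?_⟩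
    rw [tsum_fintype, ← sum_antidiagonal_pow_mul_choose (fun k => |c k|),
      ← Finset.sum_coe_sort]
    refine Finset.sum_congr rfl fun p _ => ?_
    simp
  convert hs.hasSum using 1
  rw [← (Finset.HasAntidiagonal.sigmaAntidiagonalEquivProd (A := ℕ)).tsum_eq]
  refine Eq.trans (tsum_congr fun k => ?_)
    (((Finset.HasAntidiagonal.sigmaAntidiagonalEquivProd (A := ℕ)).summable_iff.mpr hs).tsum_sigma'
      fun k => (hasSum_fintype _).summable).symm
  rw [tsum_fintype, ← sum_antidiagonal_pow_mul_choose, ← Finset.sum_coe_sort]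
  rfl

/-- For `λ ∈ (-1,1)`, the iterated series
`(1-λ) Σ_n λⁿ [((-1)ⁿ/n!) Σ_{k=n}^∞ (-1)^k/(2^k(2k)!) · (k!)²/(k-n)! · H_{2k}(r)]`
converges and equals `(1-λ) Σ_k (λ-1)^k k!/(2^k(2k)!) · H_{2k}(r)`; the inner
sum over `k ≥ n` is indexed by `j` with `k = n + j`. -/
theorem cahill_glauber_iterated_series (lam r : ℝ) (h1 : -1 < lam) (h2 : lam < 1) :
    (∀ n : ℕ, Summable (fun j : ℕ =>
        ((-1 : ℝ) ^ (n + j) / (2 ^ (n + j) * ((2 * (n + j)).factorial : ℝ))) *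
          ((((n + j).factorial : ℝ)) ^ 2 / (j.factorial : ℝ)) * hermiteH (2 * (n + j)) r)) ∧
    Summable (fun k : ℕ =>
        (lam - 1) ^ k * (k.factorial : ℝ) / (2 ^ k * ((2 * k).factorial : ℝ)) *
          hermiteH (2 * k) r) ∧
    HasSum
      (fun n : ℕ =>
        (1 - lam) * lam ^ n * (((-1 : ℝ) ^ n / (n.factorial : ℝ)) *
          ∑' j : ℕ,
            ((-1 : ℝ) ^ (n + j) / (2 ^ (n + j) * ((2 * (n + j)).factorial : ℝ))) *
              ((((n + j).factorial : ℝ)) ^ 2 / (j.factorial : ℝ)) * hermiteH (2 * (n + j)) r))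
      ((1 - lam) * ∑' k : ℕ,
        (lam - 1) ^ k * (k.factorial : ℝ) / (2 ^ k * ((2 * k).factorial : ℝ)) *
          hermiteH (2 * k) r) := by
  have hc : ∀ z : ℝ, |z| < 1 → Summable fun k => |scaledEven r k / 2 ^ k| * (1 + |z|) ^ k := by
    intro z hz
    refine (summable_abs_scaledEven_mul_pow r (q := (1 + |z|) / 2) (by positivity)
      (by linarith)).congr fun k => ?_
    rw [abs_div, abs_of_pos (by positivity : (0 : ℝ) < 2 ^ k), div_pow]
    ring
  have hterm : ∀ n j : ℕ,
      ((-1 : ℝ) ^ (n + j) / (2 ^ (n + j) * ((2 * (n + j)).factorial : ℝ))) *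
          ((((n + j).factorial : ℝ)) ^ 2 / (j.factorial : ℝ)) * hermiteH (2 * (n + j)) r =
        n.factorial * ((n + j).choose n * (scaledEven r (n + j) / 2 ^ (n + j))) := by
    intro n j
    have hn := Nat.factorial_ne_zero n
    have hj := Nat.factorial_ne_zero j
    rw [Nat.cast_add_choose]
    unfold scaledEven
    field_simp
  have hdiag : ∀ k : ℕ, (lam - 1) ^ k * (k.factorial : ℝ) / (2 ^ k * ((2 * k).factorial : ℝ)) *
      hermiteH (2 * k) r = scaledEven r k / 2 ^ k * (1 + -lam) ^ k := by
    intro k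
    rw [show lam - 1 = -1 * (1 + -lam) by ring, mul_pow]
    unfold scaledEven
    field_simp
  have hlam : |(-lam)| < 1 := by rw [abs_neg]; exact abs_lt.mpr ⟨h1, h2⟩
  have hinner : ∀ n : ℕ,
      Summable fun j => ((n + j).choose n : ℝ) * (scaledEven r (n + j) / 2 ^ (n + j)) := by
    intro n
    have hhalf := (hasSum_prod_pow_mul_choose (hc (1 / 2) (by norm_num [abs_lt]))).summable
    have hne : ((1 : ℝ) / 2) ^ n ≠ 0 := by positivity
    exact (summable_mul_left_iff hne).mp (hhalf.prod_factor n)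
  simp_rw [hterm, hdiag]
  refine ⟨fun n => (hinner n).mul_left _, ?_, ?_⟩
  · refine Summable.of_norm_bounded (hc _ hlam) fun k => ?_
    rw [Real.norm_eq_abs, abs_mul, abs_pow]
    gcongr
    exact (abs_add_le _ _).trans_eq (by rw [abs_one])
  · have hmain := (hasSum_prod_pow_mul_choose (hc _ hlam)).prod_fiberwise
      fun n => ((hinner n).mul_left _).hasSum
    refine (congrArg (HasSum · _) (funext fun n => ?_)).mpr (hmain.mul_left (1 - lam))
    rw [tsum_mul_left, tsum_mul_left, neg_pow lam]
    have hn := Nat.factorial_ne_zero n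
    field_simp

end
end

section
/- Let λ ∈ (−1,1) and set s := (λ+1)/(λ−1) (so s < 0). Then for every r ∈ ℝ, (1−λ)·Σ_{k=0}^∞ [(λ−1)^k k!/(2^k (2k)!)]·H_{2k}(r) = 2·Σ_{u=0}^∞ [(−1)^u u! (2r)^{2u}/(2u)!]·((1−λ)/(1+λ))^{u+1} = −(1/s)·Y(r/√(−s)), all series converging. -/
open MeasureTheory Filter Topology

noncomputable section

/-- Explicit formulas for the Hermite polynomials of even and odd index. -/
theorem hermiteH_explicit (r : ℝ) (k : ℕ) :
    hermiteH (2 * k) r = (2 * k).factorial * ∑ p ∈ Finset.HasAntidiagonal.antidiagonal k,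
      ((-1) ^ p.1 / (p.1.factorial : ℝ)) * ((2 * r) ^ (2 * p.2) / ((2 * p.2).factorial : ℝ)) ∧
    hermiteH (2 * k + 1) r = (2 * k + 1).factorial * ∑ p ∈ Finset.HasAntidiagonal.antidiagonal k,
      ((-1) ^ p.1 / (p.1.factorial : ℝ)) *
        ((2 * r) ^ (2 * p.2 + 1) / ((2 * p.2 + 1).factorial : ℝ)) := by
  induction k with
  | zero => simp [hermiteH]
  | succ k ih =>
    obtain ⟨he, ho⟩ := ih
    have shift (g : ℕ → ℝ) :
        ∑ p ∈ Finset.HasAntidiagonal.antidiagonal (k + 1), (p.1 : ℝ) * ((-1) ^ p.1 / (p.1.factorial : ℝ) * g p.2) =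
          -∑ p ∈ Finset.HasAntidiagonal.antidiagonal k, (-1) ^ p.1 / (p.1.factorial : ℝ) * g p.2 := by
      rw [Finset.Nat.sum_antidiagonal_succ, ← Finset.sum_neg_distrib]
      simp only [Nat.cast_zero, zero_mul, zero_add]
      refine Finset.sum_congr rfl fun p _ => ?_
      rw [Nat.factorial_succ]
      push_cast
      field_simp
      ring
    have even : hermiteH (2 * (k + 1)) r =
        (2 * (k + 1)).factorial * ∑ p ∈ Finset.HasAntidiagonal.antidiagonal (k + 1),
          ((-1) ^ p.1 / (p.1.factorial : ℝ)) *
            ((2 * r) ^ (2 * p.2) / ((2 * p.2).factorial : ℝ)) := by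
      have key : (2 * (k + 1) : ℝ) * ∑ p ∈ Finset.HasAntidiagonal.antidiagonal (k + 1),
          ((-1) ^ p.1 / (p.1.factorial : ℝ)) *
            ((2 * r) ^ (2 * p.2) / ((2 * p.2).factorial : ℝ)) =
          2 * r * (∑ p ∈ Finset.HasAntidiagonal.antidiagonal k, ((-1) ^ p.1 / (p.1.factorial : ℝ)) *
            ((2 * r) ^ (2 * p.2 + 1) / ((2 * p.2 + 1).factorial : ℝ))) -
          2 * ∑ p ∈ Finset.HasAntidiagonal.antidiagonal k, ((-1) ^ p.1 / (p.1.factorial : ℝ)) *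
            ((2 * r) ^ (2 * p.2) / ((2 * p.2).factorial : ℝ)) := by
        have hj : ∑ p ∈ Finset.HasAntidiagonal.antidiagonal (k + 1), (2 * p.2 : ℝ) *
            (((-1) ^ p.1 / (p.1.factorial : ℝ)) *
              ((2 * r) ^ (2 * p.2) / ((2 * p.2).factorial : ℝ))) =
            2 * r * (∑ p ∈ Finset.HasAntidiagonal.antidiagonal k, ((-1) ^ p.1 / (p.1.factorial : ℝ)) *
              ((2 * r) ^ (2 * p.2 + 1) / ((2 * p.2 + 1).factorial : ℝ))) := by
          rw [Finset.Nat.sum_antidiagonal_succ', Finset.mul_sum]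
          simp only [Nat.cast_zero, mul_zero, zero_mul, zero_add]
          refine Finset.sum_congr rfl fun p _ => ?_
          rw [show 2 * (p.2 + 1) = 2 * p.2 + 1 + 1 by ring, Nat.factorial_succ (2 * p.2 + 1)]
          push_cast
          field_simp
          ring
        rw [← hj, sub_eq_add_neg, ← mul_neg,
          ← shift fun j => (2 * r) ^ (2 * j) / ((2 * j).factorial : ℝ), Finset.mul_sum,
          Finset.mul_sum, ← Finset.sum_add_distrib]
        refine Finset.sum_congr rfl fun p hp => ?_
        have : (k + 1 : ℝ) = p.1 + p.2 := by
          exact_mod_cast (Finset.HasAntidiagonal.mem_antidiagonal.1 hp).symm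
        rw [this]
        ring
      rw [show 2 * (k + 1) = 2 * k + 2 by ring, hermiteH]
      beta_reduce
      rw [he, ho, Nat.factorial_succ (2 * k + 1),
        Nat.factorial_succ (2 * k)]
      push_cast
      linear_combination -((2 * k + 1) * ((2 * k).factorial : ℝ)) * key
    refine ⟨even, ?_⟩
    have key : (2 * (k + 1) + 1 : ℝ) * ∑ p ∈ Finset.HasAntidiagonal.antidiagonal (k + 1),
        ((-1) ^ p.1 / (p.1.factorial : ℝ)) *
          ((2 * r) ^ (2 * p.2 + 1) / ((2 * p.2 + 1).factorial : ℝ)) =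
        2 * r * (∑ p ∈ Finset.HasAntidiagonal.antidiagonal (k + 1), ((-1) ^ p.1 / (p.1.factorial : ℝ)) *
          ((2 * r) ^ (2 * p.2) / ((2 * p.2).factorial : ℝ))) -
        2 * ∑ p ∈ Finset.HasAntidiagonal.antidiagonal k, ((-1) ^ p.1 / (p.1.factorial : ℝ)) *
          ((2 * r) ^ (2 * p.2 + 1) / ((2 * p.2 + 1).factorial : ℝ)) := by
      rw [sub_eq_add_neg, ← mul_neg,
        ← shift fun j => (2 * r) ^ (2 * j + 1) / ((2 * j + 1).factorial : ℝ), Finset.mul_sum,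
        Finset.mul_sum, Finset.mul_sum, ← Finset.sum_add_distrib]
      refine Finset.sum_congr rfl fun p hp => ?_
      have : (k + 1 : ℝ) = p.1 + p.2 := by
        exact_mod_cast (Finset.HasAntidiagonal.mem_antidiagonal.1 hp).symm
      rw [this, Nat.factorial_succ (2 * p.2)]
      push_cast
      field_simp
      ring
    rw [show 2 * (k + 1) + 1 = (2 * k + 1) + 2 by ring, hermiteH]
    beta_reduce
    rw [show 2 * k + 1 + 1 = 2 * (k + 1) by ring, even, ho,
      show 2 * k + 1 + 2 = 2 * (k + 1) + 1 by ring, Nat.factorial_succ (2 * (k + 1)),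
      show 2 * (k + 1) = 2 * k + 1 + 1 by ring, Nat.factorial_succ (2 * k + 1)]
    rw [show 2 * k + 1 + 1 = 2 * (k + 1) by ring]
    push_cast
    linear_combination -((2 * k + 2) * ((2 * k + 1).factorial : ℝ)) * key

/-- The Beta-type integral `∫₀¹ (1 - v²)ⁿ dv`. -/
theorem integral_one_sub_sq_pow (n : ℕ) :
    ∫ v in (0:ℝ)..1, (1 - v ^ 2) ^ n =
      4 ^ n * (n.factorial : ℝ) ^ 2 / ((2 * n + 1).factorial : ℝ) := by
  induction n with
  | zero => simp
  | succ n ih =>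
    have hd : ∀ v ∈ Set.uIcc (0:ℝ) 1, HasDerivAt (fun v : ℝ => v * (1 - v ^ 2) ^ (n + 1))
        ((2 * n + 3) * (1 - v ^ 2) ^ (n + 1) - 2 * (n + 1) * (1 - v ^ 2) ^ n) v := by
      intro v _
      have := (hasDerivAt_id v).mul ((((hasDerivAt_id v).pow 2).const_sub 1).pow (n + 1))
      refine this.congr_deriv ?_
      simp
      ring
    have hF := intervalIntegral.integral_eq_sub_of_hasDerivAt hd
      (by apply Continuous.intervalIntegrable; fun_prop)
    rw [intervalIntegral.integral_sub (by apply Continuous.intervalIntegrable; fun_prop)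
      (by apply Continuous.intervalIntegrable; fun_prop), intervalIntegral.integral_const_mul,
      intervalIntegral.integral_const_mul, ih] at hF
    have hF' : (2 * n + 3 : ℝ) * ∫ v in (0:ℝ)..1, (1 - v ^ 2) ^ (n + 1) =
        2 * (n + 1) * (4 ^ n * (n.factorial : ℝ) ^ 2 / ((2 * n + 1).factorial : ℝ)) := by
      simp at hF
      linarith
    have h3 : (2 * n + 3 : ℝ) ≠ 0 := by positivity
    rw [← mul_right_inj' h3, hF', show 2 * (n + 1) + 1 = 2 * n + 1 + 1 + 1 by ring,
      Nat.factorial_succ (2 * n + 1 + 1), Nat.factorial_succ (2 * n + 1), Nat.factorial_succ n]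
    push_cast
    field_simp
    ring

theorem daw_eq_integral (z : ℝ) :
    daw z = z * ∫ v in (0:ℝ)..1, Real.exp (-(z ^ 2 * (1 - v ^ 2))) := by
  have h := intervalIntegral.smul_integral_comp_mul_left (a := 0) (b := 1)
    (fun x : ℝ => Real.exp (x ^ 2)) z
  simp only [mul_zero, mul_one, smul_eq_mul] at h
  rw [daw, ← h, mul_left_comm, ← intervalIntegral.integral_const_mul]
  congr 2
  ext v
  rw [← Real.exp_add]
  ring_nf

/-- The power series of the Dawson integral. -/
theorem hasSum_daw (z : ℝ) :
    HasSum (fun n : ℕ => (-1) ^ n * 4 ^ n * (n.factorial : ℝ) * z ^ (2 * n + 1) /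
      ((2 * n + 1).factorial : ℝ)) (daw z) := by
  have hI : HasSum (fun n : ℕ => ∫ v in (0:ℝ)..1, (-(z ^ 2 * (1 - v ^ 2))) ^ n / (n.factorial : ℝ))
      (∫ v in (0:ℝ)..1, Real.exp (-(z ^ 2 * (1 - v ^ 2)))) := by
    refine intervalIntegral.hasSum_integral_of_dominated_convergence
      (fun n _ => (z ^ 2) ^ n / (n.factorial : ℝ)) ?_ ?_ ?_ ?_ ?_
    · intro n
      exact Continuous.aestronglyMeasurable (by fun_prop)
    · refine fun n => Eventually.of_forall fun v hv => ?_
      rw [Set.uIoc_of_le zero_le_one] at hv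
      have hv2 : v ^ 2 ≤ 1 := pow_le_one₀ hv.1.le hv.2
      rw [norm_div, norm_pow, norm_neg, Real.norm_natCast, Real.norm_of_nonneg
        (mul_nonneg (sq_nonneg z) (sub_nonneg.2 hv2))]
      gcongr
      exact mul_le_of_le_one_right (sq_nonneg z) (by linarith [sq_nonneg v])
    · exact Eventually.of_forall fun v _ => Real.summable_pow_div_factorial _
    · exact intervalIntegrable_const
    · refine Eventually.of_forall fun v _ => ?_
      rw [Real.exp_eq_exp_ℝ]
      exact NormedSpace.expSeries_div_hasSum_exp _
  rw [daw_eq_integral]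
  convert! hI.mul_left z using 2 with n
  have : ∀ v : ℝ, (-(z ^ 2 * (1 - v ^ 2))) ^ n / (n.factorial : ℝ) =
      ((-1) ^ n * z ^ (2 * n) / (n.factorial : ℝ)) * (1 - v ^ 2) ^ n := by
    intro v
    rw [neg_pow, mul_pow, ← pow_mul]
    ring
  simp_rw [this]
  rw [intervalIntegral.integral_const_mul, integral_one_sub_sq_pow]
  field_simp
  ring

theorem hasSum_Yf (z : ℝ) :
    HasSum (fun u : ℕ => 2 * ((-1 : ℝ) ^ u * (u.factorial : ℝ) * (2 * z) ^ (2 * u) /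
      ((2 * u).factorial : ℝ))) (Yf z) := by
  refine HasSum.mul_left 2 ?_
  rw [← hasSum_nat_add_iff' 1]
  convert! (hasSum_daw z).mul_left (-(2 * z)) using 1
  · ext n
    rw [show 2 * (n + 1) = 2 * n + 1 + 1 by ring, Nat.factorial_succ (2 * n + 1),
      Nat.factorial_succ n, mul_pow, show (2:ℝ) ^ (2 * n + 1 + 1) = 4 * 4 ^ n by
        rw [show (4:ℝ) = 2 ^ 2 by norm_num, ← pow_mul]; ring]
    push_cast
    field_simp
    ring
  · simp

/-- Resummation of a triangular double series through `∑ₖ C(k, j) xᵏ = xʲ / (1 - x)ʲ⁺¹`. -/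
theorem hasSum_sum_antidiagonal_choose_geometric {a : ℕ → ℝ} {x S : ℝ} (hx0 : 0 ≤ x) (hx1 : x < 1)
    (ha : HasSum (fun j => a j * (x ^ j / (1 - x) ^ (j + 1))) S) :
    HasSum (fun k => ∑ p ∈ Finset.HasAntidiagonal.antidiagonal k, a p.2 * (k.choose p.2 * x ^ k)) S := by
  have hrow (j : ℕ) :
      HasSum (fun i : ℕ => ((i + j).choose j : ℝ) * x ^ (i + j)) (x ^ j / (1 - x) ^ (j + 1)) := by
    have := (hasSum_choose_mul_geometric_of_norm_lt_one j
      (r := x) (by rwa [Real.norm_of_nonneg hx0])).mul_right (x ^ j)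
    convert! this using 1
    · ext i; ring
    · ring
  let f : ℕ × ℕ → ℝ := fun p => a p.2 * ((p.1 + p.2).choose p.2 * x ^ (p.1 + p.2))
  have hs : Summable fun q : ℕ × ℕ => f q.swap := by
    refine Summable.of_norm ?_
    have hn (j : ℕ) : HasSum (fun i => ‖f (Prod.swap (j, i))‖)
        ‖a j * (x ^ j / (1 - x) ^ (j + 1))‖ := by
      have h1 : 0 ≤ x ^ j / (1 - x) ^ (j + 1) := by
        have := sub_pos.2 hx1
        positivity
      rw [norm_mul, Real.norm_of_nonneg h1]
      convert! (hrow j).mul_left ‖a j‖ using 2 with i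
      simp only [f, Prod.swap_prod_mk, norm_mul]
      rw [Real.norm_natCast, Real.norm_of_nonneg (pow_nonneg hx0 _)]
    rw [summable_prod_of_nonneg fun _ => norm_nonneg _]
    refine ⟨fun j => (hn j).summable, ?_⟩
    simp_rw [fun j => (hn j).tsum_eq]
    exact ha.summable.norm
  have hS : HasSum f S := by
    rw [← (Equiv.prodComm ℕ ℕ).hasSum_iff]
    have h := hs.hasSum
    have h' := h.prod_fiberwise fun j => (hrow j).mul_left (a j)
    rwa [← h'.unique ha]
  have h2 := (Finset.HasAntidiagonal.sigmaAntidiagonalEquivProd (A := ℕ)).hasSum_iff.2 hS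
  convert! h2.sigma fun k => hasSum_fintype _ using 2 with k
  rw [Finset.univ_eq_attach, ← Finset.sum_attach]
  refine Finset.sum_congr rfl fun p _ => ?_
  have hp := Finset.HasAntidiagonal.mem_antidiagonal.1 p.2
  simp [f, hp]

/-- For `λ ∈ (-1,1)` and `s := (λ+1)/(λ-1)`,
`(1-λ) Σ_k (λ-1)^k k!/(2^k(2k)!) H_{2k}(r) = 2 Σ_u (-1)^u u!(2r)^{2u}/(2u)! · ((1-λ)/(1+λ))^{u+1}
= -(1/s)·Y(r/√(-s))`, all series converging. -/
theorem cahill_glauber_kernel_density (lam r : ℝ) (h1 : -1 < lam) (h2 : lam < 1)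
    (s : ℝ) (hs : s = (lam + 1) / (lam - 1)) :
    HasSum
      (fun k : ℕ =>
        (1 - lam) * ((lam - 1) ^ k * (k.factorial : ℝ) / (2 ^ k * ((2 * k).factorial : ℝ))) *
          hermiteH (2 * k) r)
      (-(1 / s) * Yf (r / Real.sqrt (-s))) ∧
    HasSum
      (fun u : ℕ =>
        2 * ((-1 : ℝ) ^ u * (u.factorial : ℝ) * (2 * r) ^ (2 * u) / ((2 * u).factorial : ℝ)) *
          ((1 - lam) / (1 + lam)) ^ (u + 1))
      (-(1 / s) * Yf (r / Real.sqrt (-s))) := by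
  have ht : 0 < (1 - lam) / (1 + lam) := div_pos (by linarith) (by linarith)
  set t := (1 - lam) / (1 + lam) with htdef
  have hl1 : 1 + lam ≠ 0 := by linarith
  have hl2 : 1 - lam ≠ 0 := by linarith
  have hst : -(1 / s) = t := by
    rw [hs, htdef, one_div_div, ← neg_div, neg_sub, add_comm lam]
  have hst' : -s = t⁻¹ := by
    rw [← hst, one_div, ← inv_neg, inv_inv]
  have hrt : r / Real.sqrt (-s) = r * Real.sqrt t := by
    rw [hst', Real.sqrt_inv, div_inv_eq_mul]
  have hB : HasSum
      (fun u : ℕ =>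
        2 * ((-1 : ℝ) ^ u * (u.factorial : ℝ) * (2 * r) ^ (2 * u) / ((2 * u).factorial : ℝ)) *
          t ^ (u + 1))
      (-(1 / s) * Yf (r / Real.sqrt (-s))) := by
    rw [hst, hrt]
    convert! (hasSum_Yf (r * Real.sqrt t)).mul_left t using 2 with u
    rw [← mul_assoc 2 r, mul_pow (2 * r), pow_mul (Real.sqrt t), Real.sq_sqrt ht.le]
    ring
  refine ⟨?_, hB⟩
  have hx : 1 - (1 - lam) / 2 = (1 + lam) / 2 := by ring
  have hA := hasSum_sum_antidiagonal_choose_geometric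
    (a := fun j => (1 - lam) * ((-1) ^ j * (j.factorial : ℝ) * (2 * r) ^ (2 * j) /
      ((2 * j).factorial : ℝ))) (x := (1 - lam) / 2) (S := -(1 / s) * Yf (r / Real.sqrt (-s)))
    (by linarith) (by linarith) (by
      convert! hB using 2 with u
      rw [hx, htdef, div_pow, div_pow, div_pow]
      field_simp
      ring)
  convert! hA using 2 with k
  rw [(hermiteH_explicit r k).1, Finset.mul_sum, Finset.mul_sum]
  refine Finset.sum_congr rfl fun p hp => ?_
  obtain rfl := Finset.HasAntidiagonal.mem_antidiagonal.1 hp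
  have hc : ((p.1 + p.2).choose p.2 : ℝ) * (p.1.factorial * p.2.factorial) =
      (p.1 + p.2).factorial := by
    have := Nat.add_choose_mul_factorial_mul_factorial p.1 p.2
    rw [← mul_assoc]
    exact_mod_cast this
  have hsq : ((-1 : ℝ) ^ p.1) ^ 2 = 1 := by rw [← pow_mul, mul_comm, pow_mul]; simp
  rw [← hc, show lam - 1 = -1 * (1 - lam) by ring, mul_pow, div_pow, pow_add (-1 : ℝ)]
  field_simp
  linear_combination ((p.1 + p.2).choose p.2 : ℝ) * (2 * r) ^ (2 * p.2) * hsq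

end
end

section
/- Let χ_{[0,1]} denote the indicator function of the interval [0,1]. For every r ∈ ℝ with r ≠ 0 and r ≠ 1, the principal value limit lim_{ε→0⁺} ∫_{{x : |r−x|>ε}} χ_{[0,1]}(x)/(r−x) dx exists and equals ln|r/(r−1)|; that is, π·(Hχ_{[0,1]})(r) = ln|r/(r−1)|. -/
open MeasureTheory Filter Topology

noncomputable section

/-- The integral of `x ↦ 1 / (r - x)` over an interval that avoids `r`. -/
theorem integral_Icc_inv_sub {a b r : ℝ} (hab : a ≤ b) (hr : r ∉ Set.Icc a b) :
    ∫ x in Set.Icc a b, (r - x)⁻¹ = Real.log (r - a) - Real.log (r - b) := by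
  have ha : r - a ≠ 0 := fun h => hr ⟨by linarith, by linarith⟩
  have hb : r - b ≠ 0 := fun h => hr ⟨by linarith, by linarith⟩
  rw [integral_Icc_eq_integral_Ioc, ← intervalIntegral.integral_of_le hab,
    intervalIntegral.integral_comp_sub_left (fun x => x⁻¹), integral_inv, Real.log_div ha hb]
  rw [Set.uIcc_of_le (by linarith)]
  exact fun h => hr ⟨by linarith [h.2], by linarith [h.1]⟩

theorem integrableOn_Icc_inv_sub {a b r : ℝ} (hr : r ∉ Set.Icc a b) :
    IntegrableOn (fun x => (r - x)⁻¹) (Set.Icc a b) := by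
  refine ContinuousOn.integrableOn_Icc (ContinuousOn.inv₀ (by fun_prop) fun x hx h => hr ?_)
  rwa [sub_eq_zero.mp h]

/-- Truncating the singular integral restricts `1 / (r - x)` to the part of `[0, 1]` at distance
more than `ε` from `r`. -/
theorem setIntegral_indicator_Icc_div_sub (r ε : ℝ) :
    ∫ x in {x : ℝ | ε < |r - x|},
        Set.indicator (Set.Icc (0:ℝ) 1) (fun _ => (1:ℝ)) x / (r - x) =
      ∫ x in {x : ℝ | ε < |r - x|} ∩ Set.Icc 0 1, (r - x)⁻¹ := by
  rw [← setIntegral_indicator measurableSet_Icc]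
  congr 1 with x
  by_cases hx : x ∈ Set.Icc (0:ℝ) 1 <;> simp [hx]

/-- For `r ≠ 0`, `r ≠ 1`, the principal value limit
`lim_{ε→0⁺} ∫_{|r-x|>ε} χ_{[0,1]}(x)/(r-x) dx` exists and equals `ln|r/(r-1)|`;
that is, `π·(Hχ_{[0,1]})(r) = ln|r/(r-1)|`. -/
theorem hilbert_transform_indicator (r : ℝ) (h0 : r ≠ 0) (h1 : r ≠ 1) :
    Tendsto
      (fun ε : ℝ =>
        ∫ x in {x : ℝ | ε < |r - x|},
          Set.indicator (Set.Icc (0:ℝ) 1) (fun _ => (1:ℝ)) x / (r - x))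
      (𝓝[>] (0:ℝ)) (𝓝 (Real.log |r / (r - 1)|)) := by
  rw [Real.log_abs, Real.log_div h0 (sub_ne_zero.mpr h1)]
  refine tendsto_const_nhds.congr' ?_
  by_cases hr : r ∈ Set.Icc (0:ℝ) 1
  · have hr0 : 0 < r := lt_of_le_of_ne hr.1 h0.symm
    have hr1 : r < 1 := lt_of_le_of_ne hr.2 h1
    filter_upwards [Ioo_mem_nhdsGT hr0, Ioo_mem_nhdsGT (sub_pos.mpr hr1)] with ε hε hε'
    have hpos : 0 < ε := hε.1
    have hset : {x : ℝ | ε < |r - x|} ∩ Set.Icc 0 1 =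
        Set.Ico 0 (r - ε) ∪ Set.Ioc (r + ε) 1 := by
      ext x
      simp only [Set.mem_inter_iff, Set.mem_ofPred_eq, Set.mem_Icc, Set.mem_union, Set.mem_Ico,
        Set.mem_Ioc, lt_abs]
      grind
    have hl : r ∉ Set.Icc 0 (r - ε) := fun h => by linarith [h.2]
    have hu : r ∉ Set.Icc (r + ε) 1 := fun h => by linarith [h.1]
    have hdisj : Disjoint (Set.Ico 0 (r - ε)) (Set.Ioc (r + ε) 1) :=
      Set.disjoint_left.mpr fun x hx hx' => by linarith [hx.2, hx'.1]
    rw [setIntegral_indicator_Icc_div_sub, hset,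
      setIntegral_union hdisj measurableSet_Ioc
        ((integrableOn_Icc_inv_sub hl).mono_set Set.Ico_subset_Icc_self)
        ((integrableOn_Icc_inv_sub hu).mono_set Set.Ioc_subset_Icc_self),
      ← integral_Icc_eq_integral_Ico, ← integral_Icc_eq_integral_Ioc,
      integral_Icc_inv_sub (by linarith [hε.2]) hl, integral_Icc_inv_sub (by linarith [hε'.2]) hu]
    simp
  · obtain ⟨δ, hδ, hball⟩ := Metric.isOpen_iff.mp (isClosed_Icc (a := (0:ℝ)) (b := 1)).isOpen_compl
      r hr
    filter_upwards [Ioo_mem_nhdsGT hδ] with ε hε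
    have hsub : Set.Icc (0:ℝ) 1 ⊆ {x : ℝ | ε < |r - x|} := fun x hx => by
      by_contra h
      refine hball (a := x) ?_ hx
      rw [Metric.mem_ball, dist_comm, Real.dist_eq]
      exact (not_lt.mp h).trans_lt hε.2
    rw [setIntegral_indicator_Icc_div_sub, Set.inter_eq_right.mpr hsub,
      integral_Icc_inv_sub zero_le_one hr, sub_zero]

end
end

section
/- Convolution theorem for the Radon transform: for all f, g ∈ L¹(ℝ²), the Radon transform of the convolution f*g satisfies [R(f*g)](θ,r) = ∫_ℝ (Rf)(θ, r−s)·(Rg)(θ, s) ds for almost every (θ,r) ∈ [0,2π)×ℝ. -/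
open MeasureTheory Filter Topology

noncomputable section

/-- The Radon transform of `f : ℝ² → ℂ`:
`(Rf)(θ,r) = ∫ f(r cos θ - t sin θ, r sin θ + t cos θ) dt`. -/
def radonT (f : ℝ × ℝ → ℂ) (θ r : ℝ) : ℂ :=
  ∫ t : ℝ, f (r * Real.cos θ - t * Real.sin θ, r * Real.sin θ + t * Real.cos θ)

/-- Rotation of the plane by the angle `θ`, as a measurable equivalence. -/
def planeRotation (θ : ℝ) : ℝ × ℝ ≃ᵐ ℝ × ℝ :=
  (Complex.measurableEquivRealProd.symm.trans
    (rotation (Circle.exp θ)).toMeasurableEquiv).trans Complex.measurableEquivRealProd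

lemma planeRotation_apply (θ : ℝ) (p : ℝ × ℝ) :
    planeRotation θ p = (p.1 * Real.cos θ - p.2 * Real.sin θ,
      p.1 * Real.sin θ + p.2 * Real.cos θ) := by
  have h : planeRotation θ p = Complex.measurableEquivRealProd
      (rotation (Circle.exp θ) (Complex.measurableEquivRealProd.symm p)) := rfl
  rw [h, rotation_apply, Circle.coe_exp, Complex.measurableEquivRealProd_apply,
    Complex.exp_mul_I, ← Complex.ofReal_cos, ← Complex.ofReal_sin]
  ext <;> simp [Complex.cos_ofReal_re, Complex.sin_ofReal_re] <;> ring

lemma planeRotation_sub (θ : ℝ) (p q : ℝ × ℝ) :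
    planeRotation θ (p - q) = planeRotation θ p - planeRotation θ q := by
  simp only [planeRotation_apply]
  ext <;> simp <;> ring

lemma measurePreserving_planeRotation (θ : ℝ) :
    MeasurePreserving (planeRotation θ) := by
  refine MeasurePreserving.trans (μb := volume)
    (MeasurePreserving.trans (μb := volume) ?_ ?_) ?_
  · exact Complex.volume_preserving_equiv_real_prod.symm _
  · exact (rotation (Circle.exp θ)).measurePreserving
  · exact Complex.volume_preserving_equiv_real_prod

lemma radonT_eq_integral_comp (f : ℝ × ℝ → ℂ) (θ r : ℝ) :
    radonT f θ r = ∫ t : ℝ, (f ∘ planeRotation θ) (r, t) := by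
  simp [radonT, planeRotation_apply]

lemma radonT_congr_ae {f f' : ℝ × ℝ → ℂ} (h : f =ᵐ[volume] f') (θ : ℝ) :
    radonT f θ =ᵐ[volume] radonT f' θ := by
  have h1 := (measurePreserving_planeRotation θ).quasiMeasurePreserving.ae_eq_comp h
  filter_upwards [Measure.ae_ae_of_ae_prod h1] with r hr
  simp only [radonT_eq_integral_comp]
  exact integral_congr_ae hr

lemma StronglyMeasurable.radonT {f : ℝ × ℝ → ℂ} (hf : StronglyMeasurable f) :
    StronglyMeasurable (fun p : ℝ × ℝ => radonT f p.1 p.2) := by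
  refine StronglyMeasurable.integral_prod_right' (f := fun q : (ℝ × ℝ) × ℝ =>
    f (q.1.2 * Real.cos q.1.1 - q.2 * Real.sin q.1.1,
      q.1.2 * Real.sin q.1.1 + q.2 * Real.cos q.1.1)) ?_
  exact hf.comp_measurable (by fun_prop)

/-- The marginal of a convolution is the convolution of the marginals. -/
lemma ae_integral_convolution_eq {F G : ℝ × ℝ → ℂ} (hF : Integrable F) (hG : Integrable G) :
    ∀ᵐ r : ℝ, ∫ t : ℝ, ∫ w : ℝ × ℝ, F ((r, t) - w) * G w =
      ∫ s : ℝ, (∫ t : ℝ, F (r - s, t)) * ∫ u : ℝ, G (s, u) := by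
  have h1 : Integrable (fun p : (ℝ × ℝ) × (ℝ × ℝ) => F (p.1 - p.2) * G p.2) := by
    have h : Integrable (fun p : (ℝ × ℝ) × (ℝ × ℝ) => G p.2 * F (p.1 - p.2)) :=
      hG.convolution_integrand (ContinuousLinearMap.mul ℝ ℂ) hF
    simpa only [mul_comm] using h
  have h2 : Integrable (fun p : ℝ × (ℝ × (ℝ × ℝ)) => F ((p.1, p.2.1) - p.2.2) * G p.2.2) :=
    ((volume_preserving_prodAssoc (α₁ := ℝ) (β₁ := ℝ)
      (γ₁ := ℝ × ℝ)).symm).integrable_comp_of_integrable h1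
  filter_upwards [h2.prod_right_ae] with r hr
  have h3 : ∀ w : ℝ × ℝ, ∫ t : ℝ, F ((r, t) - w) * G w =
      (∫ t : ℝ, F (r - w.1, t)) * G w := fun w => by
    rw [integral_mul_const]
    congr 1
    exact integral_sub_right_eq_self (fun t => F (r - w.1, t)) w.2
  have h4 : Integrable (fun w : ℝ × ℝ => (∫ t : ℝ, F (r - w.1, t)) * G w) := by
    have := hr.integral_prod_right
    simpa only [h3] using this
  rw [integral_integral_swap hr]
  simp only [h3]
  rw [Measure.volume_eq_prod, integral_prod _ h4]
  simp only [integral_const_mul]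

theorem radonT_convolution_ae {f g : ℝ × ℝ → ℂ} (hf : Integrable f) (hg : Integrable g) (θ : ℝ) :
    ∀ᵐ r : ℝ, radonT (fun q => ∫ w : ℝ × ℝ, f (q.1 - w.1, q.2 - w.2) * g w) θ r =
      ∫ s : ℝ, radonT f θ (r - s) * radonT g θ s := by
  have hρ := measurePreserving_planeRotation θ
  filter_upwards [ae_integral_convolution_eq (hρ.integrable_comp_of_integrable hf)
    (hρ.integrable_comp_of_integrable hg)] with r hr
  simp only [radonT_eq_integral_comp, ← hr]
  congr 1 with t
  simp only [Function.comp_apply, planeRotation_sub]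
  exact (hρ.integral_comp' (fun w => f (planeRotation θ (r, t) - w) * g w)).symm

/-- Convolution theorem for the Radon transform: for integrable `f, g` on `ℝ²`,
`R(f*g)(θ,r) = ∫ (Rf)(θ,r-s)(Rg)(θ,s) ds` for almost every `(θ,r) ∈ [0,2π)×ℝ`. -/
theorem radon_convolution (f g : ℝ × ℝ → ℂ) (hf : Integrable f) (hg : Integrable g) :
    ∀ᵐ p : ℝ × ℝ ∂(volume.restrict (Set.Ico 0 (2 * Real.pi) ×ˢ (Set.univ : Set ℝ))),
      radonT (fun q => ∫ w : ℝ × ℝ, f (q.1 - w.1, q.2 - w.2) * g w) p.1 p.2 =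
        ∫ s : ℝ, radonT f p.1 (p.2 - s) * radonT g p.1 s := by
  refine ae_restrict_of_ae ?_
  obtain ⟨f', hf'm, hff'⟩ := hf.aestronglyMeasurable
  obtain ⟨g', hg'm, hgg'⟩ := hg.aestronglyMeasurable
  have hconv : (fun q : ℝ × ℝ => ∫ w : ℝ × ℝ, f (q.1 - w.1, q.2 - w.2) * g w) =
      fun q => ∫ w : ℝ × ℝ, f' (q.1 - w.1, q.2 - w.2) * g' w := by
    funext q
    refine integral_congr_ae ?_
    have h := (quasiMeasurePreserving_sub_left (volume : Measure (ℝ × ℝ)) q).ae_eq_comp hff'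
    exact h.mul hgg'
  have hmarg (θ r : ℝ) : ∫ s : ℝ, radonT f θ (r - s) * radonT g θ s =
      ∫ s : ℝ, radonT f' θ (r - s) * radonT g' θ s := by
    refine integral_congr_ae ?_
    have h := (quasiMeasurePreserving_sub_left (volume : Measure ℝ) r).ae_eq_comp
      (radonT_congr_ae hff' θ)
    exact h.mul (radonT_congr_ae hgg' θ)
  simp only [hconv, hmarg]
  have hL : StronglyMeasurable (fun p : ℝ × ℝ =>
      radonT (fun q => ∫ w : ℝ × ℝ, f' (q.1 - w.1, q.2 - w.2) * g' w) p.1 p.2) := by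
    refine StronglyMeasurable.radonT (StronglyMeasurable.integral_prod_right'
      (f := fun x : (ℝ × ℝ) × (ℝ × ℝ) => f' (x.1.1 - x.2.1, x.1.2 - x.2.2) * g' x.2) ?_)
    exact (hf'm.comp_measurable (by fun_prop)).mul (hg'm.comp_measurable (by fun_prop))
  have hR : StronglyMeasurable (fun p : ℝ × ℝ =>
      ∫ s : ℝ, radonT f' p.1 (p.2 - s) * radonT g' p.1 s) := by
    refine StronglyMeasurable.integral_prod_right'
      (f := fun x : (ℝ × ℝ) × ℝ => radonT f' x.1.1 (x.1.2 - x.2) * radonT g' x.1.1 x.2) ?_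
    exact ((StronglyMeasurable.radonT hf'm).comp_measurable
        (g := fun x : (ℝ × ℝ) × ℝ => (x.1.1, x.1.2 - x.2)) (by fun_prop)).mul
      ((StronglyMeasurable.radonT hg'm).comp_measurable
        (g := fun x : (ℝ × ℝ) × ℝ => (x.1.1, x.2)) (by fun_prop))
  refine (Measure.ae_prod_iff_ae_ae (hL.measurableSet_eq_fun hR)).2 (ae_of_all _ fun θ => ?_)
  exact radonT_convolution_ae (hf.congr hff') (hg.congr hgg') θ

end
end

section
/- Duality between the Radon transform and the backprojection operator: for every f ∈ L¹(ℝ²) and every bounded measurable function φ : [0,2π)×ℝ → ℂ, (1/2π)·∫₀^{2π} ∫_ℝ (Rf)(θ,r)·φ(θ,r) dr dθ = ∫∫_{ℝ²} f(x,y)·(R*φ)(x,y) dx dy. -/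
open MeasureTheory Filter Topology

noncomputable section

/-- The backprojection operator `(R*φ)(x,y) = (1/2π)∫₀^{2π} φ(θ, x cos θ + y sin θ) dθ`. -/
def backproj (φ : ℝ × ℝ → ℂ) (x y : ℝ) : ℂ :=
  (1 / (2 * Real.pi) : ℂ) * ∫ θ in Set.Ico 0 (2 * Real.pi), φ (θ, x * Real.cos θ + y * Real.sin θ)

/-- The rotation of the plane by the angle `θ` preserves Lebesgue measure. -/
theorem measurePreserving_rotation (θ : ℝ) :
    MeasurePreserving (fun p : ℝ × ℝ ↦
      (p.1 * Real.cos θ - p.2 * Real.sin θ, p.1 * Real.sin θ + p.2 * Real.cos θ)) := by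
  let L : ℝ × ℝ →ₗ[ℝ] ℝ × ℝ :=
    Matrix.toLin (Module.Basis.finTwoProd ℝ) (Module.Basis.finTwoProd ℝ)
      !![Real.cos θ, -Real.sin θ; Real.sin θ, Real.cos θ]
  have hdet : LinearMap.det L = 1 := by
    rw [LinearMap.det_toLin, Matrix.det_fin_two_of]
    linarith [Real.cos_sq_add_sin_sq θ]
  have hL : ⇑L = fun p : ℝ × ℝ ↦
      (p.1 * Real.cos θ - p.2 * Real.sin θ, p.1 * Real.sin θ + p.2 * Real.cos θ) := by
    ext p <;> simp [L, Matrix.toLin_finTwoProd_apply] <;> ring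
  refine ⟨by fun_prop, ?_⟩
  rw [← hL, Measure.map_linearMap_addHaar_eq_smul_addHaar volume (by simp [hdet]), hdet]
  simp

/-- Integrating `Rf(θ, ·)` against `g` is integrating `f` against the ridge function of `g` in the
direction `θ`. -/
theorem integral_radonT_mul (f : ℝ × ℝ → ℂ) (hf : Integrable f) (g : ℝ → ℂ) (hg : Measurable g)
    (C : ℝ) (hgb : ∀ r, ‖g r‖ ≤ C) (θ : ℝ) :
    ∫ r : ℝ, radonT f θ r * g r =
      ∫ p : ℝ × ℝ, f p * g (p.1 * Real.cos θ + p.2 * Real.sin θ) := by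
  let F : ℝ × ℝ → ℂ := fun p ↦ f p * g (p.1 * Real.cos θ + p.2 * Real.sin θ)
  have hF : Integrable F :=
    hf.mul_bdd (Measurable.aestronglyMeasurable (by fun_prop)) (.of_forall fun _ ↦ hgb _)
  have hrot := measurePreserving_rotation θ
  have hFint : Integrable (fun p : ℝ × ℝ ↦
      F (p.1 * Real.cos θ - p.2 * Real.sin θ, p.1 * Real.sin θ + p.2 * Real.cos θ)) :=
    hrot.integrable_comp_of_integrable hF
  have hFrot (r t : ℝ) :
      F (r * Real.cos θ - t * Real.sin θ, r * Real.sin θ + t * Real.cos θ) =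
        f (r * Real.cos θ - t * Real.sin θ, r * Real.sin θ + t * Real.cos θ) * g r := by
    have : (r * Real.cos θ - t * Real.sin θ) * Real.cos θ +
        (r * Real.sin θ + t * Real.cos θ) * Real.sin θ = r := by
      linear_combination r * Real.cos_sq_add_sin_sq θ
    simp only [F, this]
  change _ = ∫ p, F p
  rw [← hrot.map_eq, integral_map hrot.aemeasurable (by rw [hrot.map_eq]; exact hF.1),
    Measure.volume_eq_prod, integral_prod _ hFint]
  simp only [hFrot, integral_mul_const, radonT]

/-- Duality between the Radon transform and the backprojection operator: for integrable `f`
and bounded measurable `φ`,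
`(1/2π)∫₀^{2π}∫ (Rf)(θ,r)φ(θ,r) dr dθ = ∫∫ f(x,y)(R*φ)(x,y) dx dy`. -/
theorem radon_backprojection_duality (f : ℝ × ℝ → ℂ) (hf : Integrable f)
    (φ : ℝ × ℝ → ℂ) (hφm : Measurable φ) (C : ℝ) (hφb : ∀ p, ‖φ p‖ ≤ C) :
    (1 / (2 * Real.pi) : ℂ) *
        (∫ θ in Set.Ico 0 (2 * Real.pi), ∫ r : ℝ, radonT f θ r * φ (θ, r)) =
      ∫ p : ℝ × ℝ, f p * backproj φ p.1 p.2 := by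
  have hint : Integrable (fun q : ℝ × (ℝ × ℝ) ↦
      f q.2 * φ (q.1, q.2.1 * Real.cos q.1 + q.2.2 * Real.sin q.1))
      ((volume.restrict (Set.Ico 0 (2 * Real.pi))).prod volume) :=
    (hf.comp_snd _).mul_bdd (Measurable.aestronglyMeasurable (by fun_prop))
      (.of_forall fun _ ↦ hφb _)
  simp only [fun θ ↦ integral_radonT_mul f hf (fun r ↦ φ (θ, r)) (hφm.comp (by fun_prop)) C
    (fun _ ↦ hφb _) θ]
  rw [integral_integral_swap hint, ← integral_const_mul]
  simp only [backproj, integral_const_mul, mul_left_comm]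

end
end

section
/- Plancherel formula for the Radon transform: for all Schwartz functions f, g ∈ 𝒮(ℝ²), ∫∫_{ℝ²} conj(f(x,y))·g(x,y) dx dy = (1/4π²)·∫_ℝ ∫₀^{2π} conj((Rf)(θ,r))·(Λ Rg)(θ,r) dθ dr, where all the integrals and principal value limits involved exist. -/
open MeasureTheory Filter Topology

noncomputable section

theorem integral_Ioi_exp_neg_mul_mul_sin {s : ℝ} (hs : 0 < s) (a : ℝ) :
    ∫ y in Set.Ioi (0 : ℝ), Real.exp (-s * y) * Real.sin (a * y) = a / (a ^ 2 + s ^ 2) := by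
  have hre : ((-s : ℂ) + a * Complex.I).re < 0 := by simpa using hs
  have h := integral_exp_mul_complex_Ioi hre 0
  have hi := integrableOn_exp_mul_complex_Ioi hre 0
  have him : ∀ y : ℝ, Real.exp (-s * y) * Real.sin (a * y)
      = (Complex.exp (((-s : ℂ) + a * Complex.I) * y)).im := by
    intro y
    simp [Complex.exp_im]
  simp_rw [him]
  have h2 : ∫ y in Set.Ioi (0 : ℝ), (Complex.exp (((-s : ℂ) + a * Complex.I) * y)).im
      = (∫ y in Set.Ioi (0 : ℝ), Complex.exp (((-s : ℂ) + a * Complex.I) * y)).im :=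
    integral_im hi
  rw [h2, h]
  simp only [Complex.ofReal_zero, mul_zero, Complex.exp_zero, Complex.div_im]
  simp [Complex.normSq_apply]
  ring

theorem integral_Ioi_exp_neg_mul {y : ℝ} (hy : 0 < y) :
    ∫ s in Set.Ioi (0 : ℝ), Real.exp (-s * y) = y⁻¹ := by
  have := integral_exp_mul_Ioi (a := -y) (by linarith) 0
  simp only [mul_zero, Real.exp_zero] at this
  rw [neg_div_neg_eq, one_div] at this
  rw [← this]
  congr 1 with s
  ring_nf

theorem integrableOn_Ioi_exp_neg_mul {y : ℝ} (hy : 0 < y) :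
    IntegrableOn (fun s : ℝ => Real.exp (-s * y)) (Set.Ioi 0) := by
  have := integrableOn_exp_mul_Ioi (a := -y) (by linarith) 0
  refine this.congr_fun (fun s _ => ?_) measurableSet_Ioi
  simp only
  ring_nf

theorem integral_Ioi_poisson {a : ℝ} (ha : 0 < a) :
    ∫ s in Set.Ioi (0 : ℝ), a / (a ^ 2 + s ^ 2) = Real.pi / 2 := by
  have h := integral_comp_mul_left_Ioi (fun s : ℝ => a / (a ^ 2 + s ^ 2)) 0 ha
  have h2 : ∀ x : ℝ, a / (a ^ 2 + (a * x) ^ 2) = a⁻¹ * (1 + x ^ 2)⁻¹ := by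
    intro x
    have : (1 + x ^ 2) ≠ 0 := by positivity
    field_simp
  simp only [h2, mul_zero, integral_const_mul, integral_Ioi_inv_one_add_sq, Real.arctan_zero,
    sub_zero, smul_eq_mul] at h
  exact (mul_left_cancel₀ (inv_ne_zero ha.ne') h).symm

theorem integrableOn_Ioi_poisson (a : ℝ) :
    IntegrableOn (fun s : ℝ => a / (a ^ 2 + s ^ 2)) (Set.Ioi 0) := by
  have key : ∀ a : ℝ, 0 < a → IntegrableOn (fun s : ℝ => a / (a ^ 2 + s ^ 2)) (Set.Ioi 0) := by
    intro a ha
    by_contra h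
    have := integral_Ioi_poisson ha
    rw [integral_undef h] at this
    linarith [Real.pi_pos]
  rcases lt_trichotomy a 0 with h | h | h
  · have := (key (-a) (by linarith)).neg
    refine this.congr (ae_of_all _ fun s => ?_)
    simp [neg_div]
  · simp [h]
  · exact key a h

theorem integral_Ioi_poisson_abs_le (a : ℝ) :
    ∫ s in Set.Ioi (0 : ℝ), ‖a / (a ^ 2 + s ^ 2)‖ ≤ Real.pi / 2 := by
  rcases eq_or_ne a 0 with rfl | h
  · simp
    positivity
  · rw [← integral_Ioi_poisson (abs_pos.2 h)]
    refine le_of_eq ?_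
    congr 1 with s
    rw [norm_div, Real.norm_eq_abs, Real.norm_eq_abs, sq_abs,
      abs_of_nonneg (a := a ^ 2 + s ^ 2) (by positivity)]

theorem integral_Ioi_poisson_sign (a : ℝ) :
    ∫ s in Set.Ioi (0 : ℝ), a / (a ^ 2 + s ^ 2) = Real.pi / 2 * Real.sign a := by
  rcases lt_trichotomy a 0 with h | h | h
  · rw [Real.sign_of_neg h]
    have := integral_Ioi_poisson (neg_pos.2 h)
    simp only [neg_div, neg_sq, integral_neg] at this
    linarith
  · simp [h]
  · rw [Real.sign_of_pos h, integral_Ioi_poisson h, mul_one]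

/-- If `v` is the sine transform of `w`, then `∫₀^∞ v(y)/y dy` is computed by integrating `w`
against the sign function. -/
theorem integral_Ioi_inv_mul_sineTransform {w v : ℝ → ℂ} (hw : Integrable w)
    (hv : ∀ y, v y = ∫ ρ, (Real.sin (2 * Real.pi * ρ * y) : ℂ) * w ρ)
    (hvi : IntegrableOn (fun y => ((y⁻¹ : ℝ) : ℂ) * v y) (Set.Ioi 0)) (hvc : Continuous v) :
    ∫ y in Set.Ioi (0 : ℝ), ((y⁻¹ : ℝ) : ℂ) * v y
      = ∫ ρ, ((Real.pi / 2 * Real.sign ρ : ℝ) : ℂ) * w ρ := by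
  calc ∫ y in Set.Ioi (0 : ℝ), ((y⁻¹ : ℝ) : ℂ) * v y
      = ∫ y in Set.Ioi (0 : ℝ), ∫ s in Set.Ioi (0 : ℝ), (Real.exp (-s * y) : ℂ) * v y := by
        refine setIntegral_congr_fun measurableSet_Ioi fun y hy => ?_
        rw [integral_mul_const, ← integral_Ioi_exp_neg_mul hy, integral_complex_ofReal]
    _ = ∫ s in Set.Ioi (0 : ℝ), ∫ y in Set.Ioi (0 : ℝ), (Real.exp (-s * y) : ℂ) * v y := by
        refine integral_integral_swap ?_
        rw [integrable_prod_iff (by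
          apply Continuous.aestronglyMeasurable
          simp only [Function.uncurry_def]
          fun_prop)]
        constructor
        · refine (ae_restrict_iff' measurableSet_Ioi).2 (ae_of_all _ fun y hy => ?_)
          exact (integrableOn_Ioi_exp_neg_mul hy).ofReal (𝕜 := ℂ) |>.mul_const (v y)
        · refine hvi.norm.congr ?_
          refine (ae_restrict_iff' measurableSet_Ioi).2 (ae_of_all _ fun y hy => ?_)
          have hy' : (0 : ℝ) < y := hy
          simp only [Function.uncurry, norm_mul, Complex.norm_real, Real.norm_eq_abs, Real.abs_exp]
          rw [integral_mul_const, integral_Ioi_exp_neg_mul hy, abs_of_pos (by positivity)]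
    _ = ∫ s in Set.Ioi (0 : ℝ), ∫ ρ, ((2 * Real.pi * ρ / ((2 * Real.pi * ρ) ^ 2 + s ^ 2) : ℝ) : ℂ)
          * w ρ := by
        refine setIntegral_congr_fun measurableSet_Ioi fun s hs => ?_
        have hs' : (0 : ℝ) < s := hs
        simp only [hv, ← integral_const_mul]
        rw [integral_integral_swap]
        · congr 1 with ρ
          simp only [← mul_assoc, integral_mul_const]
          rw [← integral_Ioi_exp_neg_mul_mul_sin hs' (2 * Real.pi * ρ), ← integral_complex_ofReal]
          simp only [Complex.ofReal_mul]
        · have h1 : IntegrableOn (fun y : ℝ => (Real.exp (-s * y) : ℂ)) (Set.Ioi 0) := by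
            refine Integrable.ofReal (𝕜 := ℂ) (f := fun y : ℝ => Real.exp (-s * y)) ?_
            exact integrableOn_exp_mul_Ioi (neg_lt_zero.2 hs') 0
          have h2 := h1.mul_prod hw
          have h3 : Continuous (fun p : ℝ × ℝ => (Real.sin (2 * Real.pi * p.2 * p.1) : ℂ)) := by
            fun_prop
          have := h2.bdd_mul (c := 1) h3.aestronglyMeasurable (ae_of_all _ fun p => by
            rw [Complex.norm_real]
            exact Real.abs_sin_le_one _)
          refine this.congr (ae_of_all _ fun p => ?_)
          simp only [Function.uncurry]
          ring
    _ = ∫ ρ, ∫ s in Set.Ioi (0 : ℝ), ((2 * Real.pi * ρ / ((2 * Real.pi * ρ) ^ 2 + s ^ 2) : ℝ) : ℂ)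
          * w ρ := by
        refine (integral_integral_swap ?_).symm
        have hm : AEStronglyMeasurable (Function.uncurry fun ρ s : ℝ =>
            ((2 * Real.pi * ρ / ((2 * Real.pi * ρ) ^ 2 + s ^ 2) : ℝ) : ℂ) * w ρ)
            (volume.prod (volume.restrict (Set.Ioi 0))) := by
          refine AEStronglyMeasurable.mul ?_ hw.1.comp_fst
          apply Measurable.aestronglyMeasurable
          fun_prop
        rw [integrable_prod_iff hm]
        constructor
        · refine ae_of_all _ fun ρ => ?_
          exact (integrableOn_Ioi_poisson (2 * Real.pi * ρ)).ofReal (𝕜 := ℂ) |>.mul_const (w ρ)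
        · refine (hw.norm.const_mul (Real.pi / 2)).mono' ?_ (ae_of_all _ fun ρ => ?_)
          · exact hm.norm.integral_prod_right'
          · rw [Real.norm_of_nonneg (by positivity)]
            simp only [Function.uncurry, norm_mul, Complex.norm_real]
            rw [integral_mul_const]
            gcongr
            exact integral_Ioi_poisson_abs_le _
    _ = _ := by
        congr 1 with ρ
        rw [integral_mul_const, integral_complex_ofReal, integral_Ioi_poisson_sign]
        congr 3
        rcases lt_trichotomy ρ 0 with h | h | h
        · rw [Real.sign_of_neg h, Real.sign_of_neg (by nlinarith [Real.pi_pos])]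
        · simp [h]
        · rw [Real.sign_of_pos h, Real.sign_of_pos (by positivity)]

theorem integrable_cexp_mul {h : ℝ → ℂ} (hh : Integrable h) (x : ℝ) :
    Integrable fun ρ : ℝ => Complex.exp ((2 * Real.pi * ρ * x : ℝ) * Complex.I) * h ρ := by
  refine hh.bdd_mul (c := 1) (by fun_prop) (ae_of_all _ fun ρ => ?_)
  rw [Complex.norm_exp_ofReal_mul_I]

theorem SchwartzMap.integrable_ofReal_mul (S : SchwartzMap ℝ ℂ) :
    Integrable fun ρ : ℝ => (ρ : ℂ) * S ρ := by
  refine (S.integrable_pow_mul volume 1).mono' (by fun_prop) (ae_of_all _ fun ρ => ?_)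
  simp

theorem SchwartzMap.deriv_eq_integral (S : SchwartzMap ℝ ℂ) (x : ℝ) :
    deriv S x = ∫ ρ : ℝ, Complex.exp ((2 * Real.pi * ρ * x : ℝ) * Complex.I) *
      (2 * Real.pi * Complex.I * ρ * FourierTransform.fourier (⇑S) ρ) := by
  set u := SchwartzMap.derivCLM ℂ ℂ S with hu
  have hu' : ⇑u = deriv S := by
    ext x
    exact SchwartzMap.derivCLM_apply ℂ S x
  have h1 := u.continuous.fourierInv_fourier_eq u.integrable (by
    rw [← SchwartzMap.fourier_coe]
    exact SchwartzMap.integrable _)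
  rw [hu', Real.fourier_deriv S.integrable S.differentiable (hu' ▸ u.integrable)] at h1
  rw [← h1, Real.fourierInv_eq']
  congr 1 with ρ
  simp [smul_eq_mul]
  left
  ring_nf

theorem tendsto_integral_principalValue {u : ℝ → ℂ} (hu : Integrable u) (r : ℝ)
    (hvi : IntegrableOn (fun y => ((y⁻¹ : ℝ) : ℂ) * (u (r - y) - u (r + y))) (Set.Ioi 0)) :
    Tendsto (fun ε : ℝ => ∫ x in {x : ℝ | ε < |r - x|}, ((r - x : ℝ) : ℂ)⁻¹ * u x) (𝓝[>] (0 : ℝ))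
      (𝓝 (∫ y in Set.Ioi (0 : ℝ), ((y⁻¹ : ℝ) : ℂ) * (u (r - y) - u (r + y)))) := by
  have hA : AECover ((volume : Measure ℝ).restrict (Set.Ioi 0)) (𝓝[>] (0 : ℝ))
      fun ε : ℝ => Set.Ioi ε :=
    aecover_Ioi_of_Ioi (tendsto_id.mono_left nhdsWithin_le_nhds)
  refine (hA.integral_tendsto_of_countably_generated hvi).congr' ?_
  filter_upwards [self_mem_nhdsWithin] with ε hε
  have hε' : (0 : ℝ) < ε := hε
  have hset : ∀ y : ℝ, ε < |y| ↔ y ∈ Set.Iio (-ε) ∪ Set.Ioi ε := by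
    intro y
    rw [lt_abs, Set.mem_union, Set.mem_Iio, Set.mem_Ioi, or_comm, lt_neg]
  have hu1 : Integrable fun y => u (r - y) := hu.comp_sub_left r
  have hset' : {y : ℝ | ε < |y|} = Set.Iio (-ε) ∪ Set.Ioi ε := Set.ext hset
  have hmeas : MeasurableSet {y : ℝ | ε < |y|} := by
    rw [hset']
    exact measurableSet_Iio.union measurableSet_Ioi
  have hmeas' : MeasurableSet {x : ℝ | ε < |r - x|} :=
    (measurable_const.sub measurable_id) hmeas
  have hint : IntegrableOn (fun y : ℝ => ((y : ℝ) : ℂ)⁻¹ * u (r - y)) {y : ℝ | ε < |y|} := by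
    refine Integrable.bdd_mul (c := ε⁻¹) hu1.integrableOn (by
      apply Measurable.aestronglyMeasurable
      fun_prop) ?_
    refine (ae_restrict_iff' hmeas).2 (ae_of_all _ fun y hy => ?_)
    rw [norm_inv, Complex.norm_real, Real.norm_eq_abs]
    exact inv_anti₀ hε' (le_of_lt hy)
  have e1 : ∫ x in {x : ℝ | ε < |r - x|}, ((r - x : ℝ) : ℂ)⁻¹ * u x
      = ∫ y in {y : ℝ | ε < |y|}, ((y : ℝ) : ℂ)⁻¹ * u (r - y) := by
    rw [← integral_indicator hmeas, ← integral_indicator hmeas',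
      ← integral_sub_left_eq_self _ volume r]
    congr 1 with x
    simp [Set.indicator_apply]
  rw [hset'] at hint
  rw [e1, hset', setIntegral_union (by
      rw [Set.disjoint_left]
      intro y hy hy'
      rw [Set.mem_Iio] at hy
      rw [Set.mem_Ioi] at hy'
      linarith) measurableSet_Ioi hint.left_of_union hint.right_of_union]
  have e2 : ∫ y in Set.Iio (-ε), ((y : ℝ) : ℂ)⁻¹ * u (r - y)
      = ∫ y in Set.Ioi ε, -(((y : ℝ) : ℂ)⁻¹ * u (r + y)) := by
    rw [← integral_Iic_eq_integral_Iio]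
    have := integral_comp_neg_Ioi ε (fun y : ℝ => ((y : ℝ) : ℂ)⁻¹ * u (r - y))
    rw [← this]
    congr 1 with y
    simp [inv_neg]
  have hint2 : IntegrableOn (fun y : ℝ => -(((y : ℝ) : ℂ)⁻¹ * u (r + y))) (Set.Ioi ε) := by
    refine Integrable.neg ?_
    refine Integrable.bdd_mul (c := ε⁻¹) (hu.comp_add_left r).integrableOn (by
      apply Measurable.aestronglyMeasurable
      fun_prop) ?_
    refine (ae_restrict_iff' measurableSet_Ioi).2 (ae_of_all _ fun y hy => ?_)
    rw [norm_inv, Complex.norm_real, Real.norm_eq_abs]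
    exact inv_anti₀ hε' ((le_of_lt hy).trans (le_abs_self y))
  rw [e2, ← integral_add hint2 hint.right_of_union, Measure.restrict_restrict measurableSet_Ioi,
    Set.inter_eq_left.2 (Set.Ioi_subset_Ioi hε'.le)]
  congr 1 with y
  push_cast
  ring

/-- The operator `pv (1/x) * d/dx` is the Fourier multiplier with symbol `2 π² |ρ|`. -/
theorem SchwartzMap.tendsto_principalValue_deriv (S : SchwartzMap ℝ ℂ) (r : ℝ) :
    Tendsto (fun ε : ℝ => ∫ x in {x : ℝ | ε < |r - x|}, ((r - x : ℝ) : ℂ)⁻¹ * deriv S x)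
      (𝓝[>] (0 : ℝ))
      (𝓝 (∫ ρ : ℝ, ((2 * Real.pi ^ 2 * |ρ| : ℝ) : ℂ) *
        (Complex.exp ((2 * Real.pi * ρ * r : ℝ) * Complex.I) *
          FourierTransform.fourier (⇑S) ρ))) := by
  have hcoe : ⇑(FourierTransform.fourier S) = FourierTransform.fourier (⇑S) :=
    SchwartzMap.fourier_coe S
  have hu' : ⇑(SchwartzMap.derivCLM ℂ ℂ S) = deriv S := by
    ext x
    exact SchwartzMap.derivCLM_apply ℂ S x
  have hu : Integrable (deriv S) := hu' ▸ SchwartzMap.integrable _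
  have huc : Continuous (deriv S) := hu' ▸ SchwartzMap.continuous _
  set w : ℝ → ℂ := fun ρ => 4 * Real.pi * (Complex.exp ((2 * Real.pi * ρ * r : ℝ) * Complex.I) *
    (ρ * FourierTransform.fourier (⇑S) ρ)) with hw
  have hS1 : Integrable fun ρ : ℝ => (ρ : ℂ) * FourierTransform.fourier (⇑S) ρ := by
    rw [← hcoe]
    exact SchwartzMap.integrable_ofReal_mul _
  have hS2 : Integrable fun ρ : ℝ => (ρ : ℂ) * (ρ * FourierTransform.fourier (⇑S) ρ) := by
    rw [← hcoe]
    refine ((FourierTransform.fourier S).integrable_pow_mul volume 2).mono' (by fun_prop)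
      (ae_of_all _ fun ρ => le_of_eq ?_)
    simp only [norm_mul, Complex.norm_real]
    ring
  have hwi : Integrable w := (integrable_cexp_mul hS1 r).const_mul _
  have hv : ∀ y, deriv S (r - y) - deriv S (r + y)
      = ∫ ρ, (Real.sin (2 * Real.pi * ρ * y) : ℂ) * w ρ := by
    intro y
    have hS1' : Integrable fun ρ : ℝ =>
        2 * Real.pi * Complex.I * ρ * FourierTransform.fourier (⇑S) ρ := by
      refine (hS1.const_mul (2 * Real.pi * Complex.I)).congr (ae_of_all _ fun ρ => ?_)
      simp only
      ring
    rw [SchwartzMap.deriv_eq_integral, SchwartzMap.deriv_eq_integral,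
      ← integral_sub (integrable_cexp_mul hS1' _) (integrable_cexp_mul hS1' _)]
    congr 1 with ρ
    have h1 : (((2 * Real.pi * ρ * (r - y) : ℝ) : ℂ) * Complex.I)
        = ((2 * Real.pi * ρ * r : ℝ) : ℂ) * Complex.I
          + -((2 * Real.pi * ρ * y : ℝ) : ℂ) * Complex.I := by
      push_cast
      ring
    have h2 : (((2 * Real.pi * ρ * (r + y) : ℝ) : ℂ) * Complex.I)
        = ((2 * Real.pi * ρ * r : ℝ) : ℂ) * Complex.I
          + ((2 * Real.pi * ρ * y : ℝ) : ℂ) * Complex.I := by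
      push_cast
      ring
    rw [h1, h2, Complex.exp_add, Complex.exp_add, hw, Complex.ofReal_sin, Complex.sin]
    ring
  have hvi : IntegrableOn (fun y => ((y⁻¹ : ℝ) : ℂ) * (deriv S (r - y) - deriv S (r + y)))
      (Set.Ioi 0) := by
    have hm : AEStronglyMeasurable
        (fun y => ((y⁻¹ : ℝ) : ℂ) * (deriv S (r - y) - deriv S (r + y))) volume := by
      apply Measurable.aestronglyMeasurable
      have := huc.measurable
      fun_prop
    rw [← Set.Ioc_union_Ioi_eq_Ioi zero_le_one]
    refine IntegrableOn.union ?_ ?_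
    · refine Integrable.mono' (g := fun _ => ∫ ρ : ℝ, 2 * Real.pi * ‖ρ * w ρ‖)
        (integrable_const _) hm.restrict ?_
      refine (ae_restrict_iff' measurableSet_Ioc).2 (ae_of_all _ fun y hy => ?_)
      have hy0 : 0 < y := hy.1
      have hρw : Integrable fun ρ : ℝ => 2 * Real.pi * ‖ρ * w ρ‖ := by
        refine Integrable.const_mul (Integrable.norm ?_) _
        refine ((integrable_cexp_mul hS2 r).const_mul (4 * Real.pi)).congr
          (ae_of_all _ fun ρ => ?_)
        simp only [hw]
        ring
      rw [hv, ← integral_const_mul]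
      refine norm_integral_le_of_norm_le hρw (ae_of_all _ fun ρ => ?_)
      rw [norm_mul, norm_mul _ (w ρ), norm_mul (ρ : ℂ) (w ρ), Complex.norm_real, Complex.norm_real, Complex.norm_real,
        Real.norm_eq_abs, Real.norm_eq_abs, Real.norm_eq_abs, abs_inv, abs_of_pos hy0]
      have h1 : |Real.sin (2 * Real.pi * ρ * y)| ≤ 2 * Real.pi * |ρ| * y := by
        refine Real.abs_sin_le_abs.trans (le_of_eq ?_)
        rw [abs_mul, abs_mul, abs_of_pos hy0, abs_of_pos (by positivity : 0 < 2 * Real.pi)]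
      calc y⁻¹ * (|Real.sin (2 * Real.pi * ρ * y)| * ‖w ρ‖)
          ≤ y⁻¹ * ((2 * Real.pi * |ρ| * y) * ‖w ρ‖) := by gcongr
        _ = 2 * Real.pi * (|ρ| * ‖w ρ‖) := by
          field_simp
    · refine Integrable.bdd_mul (c := 1)
        ((hu.comp_sub_left r).sub (hu.comp_add_left r)).integrableOn (by
        apply Measurable.aestronglyMeasurable
        fun_prop) ?_
      refine (ae_restrict_iff' measurableSet_Ioi).2 (ae_of_all _ fun y hy => ?_)
      have hy1 : 1 < y := hy
      rw [Complex.norm_real, norm_inv, Real.norm_eq_abs, abs_of_pos (by linarith)]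
      exact inv_le_one_of_one_le₀ hy1.le
  have hlim := tendsto_integral_principalValue hu r hvi
  rw [integral_Ioi_inv_mul_sineTransform hwi hv hvi (by fun_prop)] at hlim
  convert hlim using 3
  ext ρ
  have : |ρ| = Real.sign ρ * ρ := by
    rcases lt_trichotomy ρ 0 with h | h | h
    · rw [Real.sign_of_neg h, abs_of_neg h]
      ring
    · simp [h]
    · rw [Real.sign_of_pos h, abs_of_pos h, one_mul]
  simp only [hw, this]
  push_cast
  ring

theorem abs_mul_inv_sq_le (ρ : ℝ) : |ρ| * ((1 + ρ ^ 2) ^ 2)⁻¹ ≤ (1 + ρ ^ 2)⁻¹ := by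
  rw [sq (1 + ρ ^ 2), mul_inv, ← mul_assoc]
  refine mul_le_of_le_one_left (by positivity) ?_
  rw [← div_eq_mul_inv, div_le_one (by positivity), ← sq_abs]
  nlinarith [abs_nonneg ρ, sq_nonneg (|ρ| - 1)]

theorem SchwartzMap.exists_norm_le_inv_sq (F : SchwartzMap ℂ ℂ) :
    ∃ C : ℝ, 0 ≤ C ∧ ∀ z, ‖F z‖ ≤ C * ((1 + ‖z‖ ^ 2) ^ 2)⁻¹ := by
  have h := SchwartzMap.one_add_le_sup_seminorm_apply (𝕜 := ℂ) (m := (4, 0)) (k := 4) (n := 0)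
    le_rfl le_rfl F
  refine ⟨_, (by positivity : (0 : ℝ) ≤ 2 ^ 4 *
    ((Finset.Iic (4, 0)).sup fun m : ℕ × ℕ => SchwartzMap.seminorm ℂ m.1 m.2) F), fun z => ?_⟩
  rw [← div_eq_mul_inv, le_div_iff₀ (by positivity), mul_comm]
  refine le_trans ?_ (h z)
  rw [norm_iteratedFDeriv_zero]
  gcongr
  have : 0 ≤ ‖z‖ := norm_nonneg z
  nlinarith [pow_nonneg this 3, pow_nonneg this 2]

theorem norm_add_mul_I_mul_exp_sq (r t θ : ℝ) :
    ‖((r : ℂ) + t * Complex.I) * Complex.exp (θ * Complex.I)‖ ^ 2 = r ^ 2 + t ^ 2 := by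
  rw [norm_mul, Complex.norm_exp_ofReal_mul_I, mul_one, ← Complex.normSq_eq_norm_sq,
    Complex.normSq_add_mul_I]

theorem norm_ofReal_mul_exp (ρ θ : ℝ) : ‖(ρ : ℂ) * Complex.exp (θ * Complex.I)‖ = |ρ| := by
  rw [norm_mul, Complex.norm_exp_ofReal_mul_I, mul_one, Complex.norm_real, Real.norm_eq_abs]

theorem SchwartzMap.exists_norm_le_inv_mul_inv (F : SchwartzMap ℂ ℂ) :
    ∃ C : ℝ, 0 ≤ C ∧ ∀ r t θ : ℝ, ‖F ((r + t * Complex.I) * Complex.exp (θ * Complex.I))‖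
      ≤ C * ((1 + r ^ 2)⁻¹ * (1 + t ^ 2)⁻¹) := by
  obtain ⟨C, hC, h⟩ := F.exists_norm_le_inv_sq
  refine ⟨C, hC, fun r t θ => (h _).trans ?_⟩
  rw [norm_add_mul_I_mul_exp_sq, ← mul_inv]
  gcongr
  nlinarith [sq_nonneg r, sq_nonneg t, mul_nonneg (sq_nonneg r) (sq_nonneg t)]

/-- The integral of `F` over the line of direction `i exp(iθ)` through `r exp(iθ)`: the Radon
transform of `F : ℂ → ℂ`. -/
def complexRadon (F : ℂ → ℂ) (θ r : ℝ) : ℂ :=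
  ∫ t : ℝ, F ((r + t * Complex.I) * Complex.exp (θ * Complex.I))

theorem stronglyMeasurable_complexRadon (F : SchwartzMap ℂ ℂ) :
    StronglyMeasurable fun p : ℝ × ℝ => complexRadon F p.1 p.2 := by
  refine StronglyMeasurable.integral_prod_right (f := fun (p : ℝ × ℝ) (t : ℝ) =>
    F ((p.2 + t * Complex.I) * Complex.exp (p.1 * Complex.I))) (Continuous.stronglyMeasurable ?_)
  have := F.continuous
  simp only [Function.uncurry_def]
  fun_prop

theorem continuous_complexRadon (F : SchwartzMap ℂ ℂ) (θ : ℝ) : Continuous (complexRadon F θ) := by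
  obtain ⟨C, hC, h⟩ := F.exists_norm_le_inv_mul_inv
  have := F.continuous
  refine continuous_of_dominated (bound := fun t : ℝ => C * (1 + t ^ 2)⁻¹) (fun r => ?_)
    (fun r => ae_of_all _ fun t => (h r t θ).trans ?_) (integrable_inv_one_add_sq.const_mul C)
    (ae_of_all _ fun t => by fun_prop)
  · apply Continuous.aestronglyMeasurable
    fun_prop
  · gcongr
    refine mul_le_of_le_one_left (by positivity) (inv_le_one_of_one_le₀ ?_)
    nlinarith [sq_nonneg r]

theorem exists_norm_complexRadon_le (F : SchwartzMap ℂ ℂ) :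
    ∃ C : ℝ, 0 ≤ C ∧ ∀ θ r, ‖complexRadon F θ r‖ ≤ C * (1 + r ^ 2)⁻¹ := by
  obtain ⟨C, hC, h⟩ := F.exists_norm_le_inv_mul_inv
  refine ⟨C * ∫ t : ℝ, (1 + t ^ 2)⁻¹, mul_nonneg hC (integral_nonneg fun t => by positivity),
    fun θ r => ?_⟩
  refine (norm_integral_le_of_norm_le
    ((integrable_inv_one_add_sq.const_mul ((1 + r ^ 2)⁻¹)).const_mul C)
    (ae_of_all _ fun t => h r t θ)).trans (le_of_eq ?_)
  rw [integral_const_mul, integral_const_mul]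
  ring

theorem integrable_complexRadon (F : SchwartzMap ℂ ℂ) (θ : ℝ) :
    Integrable (complexRadon F θ) := by
  obtain ⟨C, -, h⟩ := exists_norm_complexRadon_le F
  exact (integrable_inv_one_add_sq.const_mul C).mono'
    (continuous_complexRadon F θ).aestronglyMeasurable (ae_of_all _ (h θ))

/-- The Fourier slice theorem. -/
theorem fourier_complexRadon (F : SchwartzMap ℂ ℂ) (θ ρ : ℝ) :
    FourierTransform.fourier (complexRadon F θ) ρ
      = FourierTransform.fourier (⇑F) (ρ * Complex.exp (θ * Complex.I)) := by
  obtain ⟨C, hC, h⟩ := F.exists_norm_le_inv_mul_inv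
  have hF := F.continuous
  have hexp : Complex.exp (θ * Complex.I) = (Circle.exp θ : ℂ) := (Circle.coe_exp θ).symm
  rw [Real.fourier_eq', Real.fourier_eq',
    ← ((rotation (Circle.exp θ)).measurePreserving).integral_comp
      (rotation (Circle.exp θ)).toHomeomorph.measurableEmbedding,
    ← Complex.volume_preserving_equiv_real_prod.symm.integral_comp
      Complex.measurableEquivRealProd.symm.measurableEmbedding]
  have hpt : ∀ p : ℝ × ℝ, rotation (Circle.exp θ) (Complex.measurableEquivRealProd.symm p)
      = (p.1 + p.2 * Complex.I) * Complex.exp (θ * Complex.I) := by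
    intro p
    rw [rotation_apply, Complex.measurableEquivRealProd_symm_apply, hexp, mul_comm,
      Complex.mk_eq_add_mul_I]
  have hinner : ∀ p : ℝ × ℝ, inner ℝ ((p.1 + p.2 * Complex.I) * Complex.exp (θ * Complex.I))
      (ρ * Complex.exp (θ * Complex.I)) = p.1 * ρ := by
    intro p
    have h1 : Complex.exp (θ * Complex.I) * (starRingEnd ℂ) (Complex.exp (θ * Complex.I)) = 1 := by
      rw [Complex.mul_conj, Complex.normSq_eq_norm_sq, Complex.norm_exp_ofReal_mul_I]
      simp
    rw [Complex.inner, map_mul, show (ρ : ℂ) * Complex.exp (θ * Complex.I) *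
      ((starRingEnd ℂ) (p.1 + p.2 * Complex.I) * (starRingEnd ℂ) (Complex.exp (θ * Complex.I)))
      = ρ * (starRingEnd ℂ) (p.1 + p.2 * Complex.I) * (Complex.exp (θ * Complex.I) *
        (starRingEnd ℂ) (Complex.exp (θ * Complex.I))) by ring, h1]
    simp [mul_comm]
  simp only [hpt, hinner]
  rw [Measure.volume_eq_prod, integral_prod]
  · congr 1 with r
    rw [complexRadon, ← integral_smul]
    simp [mul_comm]
  · refine ((integrable_inv_one_add_sq.mul_prod integrable_inv_one_add_sq).const_mul C).mono' ?_
      (ae_of_all _ fun p => ?_)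
    · apply Continuous.aestronglyMeasurable
      fun_prop
    · rw [norm_smul, Complex.norm_exp_ofReal_mul_I, one_mul]
      exact h _ _ _

theorem exists_schwartzMap_eq_complexRadon (F : SchwartzMap ℂ ℂ) (θ : ℝ) :
    ∃ S : SchwartzMap ℝ ℂ, ⇑S = complexRadon F θ := by
  let e : ℝ →L[ℝ] ℂ := ContinuousLinearMap.toSpanSingleton ℝ (Complex.exp (θ * Complex.I))
  have he : ∀ ρ : ℝ, e ρ = ρ * Complex.exp (θ * Complex.I) := fun ρ => by
    simp [e, ContinuousLinearMap.toSpanSingleton_apply]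
  have hanti : AntilipschitzWith 1 e := by
    refine e.antilipschitz_of_bound fun ρ => ?_
    rw [he, norm_ofReal_mul_exp]
    simp
  let G : SchwartzMap ℝ ℂ := SchwartzMap.compCLMOfAntilipschitz ℂ e.hasTemperateGrowth hanti
    (FourierTransform.fourier F)
  have hG : ⇑G = FourierTransform.fourier (complexRadon F θ) := by
    ext ρ
    rw [fourier_complexRadon, ← he, ← SchwartzMap.fourier_coe]
    rfl
  refine ⟨FourierTransformInv.fourierInv G, ?_⟩
  rw [SchwartzMap.fourierInv_coe, hG]
  exact (continuous_complexRadon F θ).fourierInv_fourier_eq (integrable_complexRadon F θ)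
    (hG ▸ G.integrable)

theorem integral_Ico_integral_abs_mul_polar {Φ : ℂ → ℂ} (hΦ : Continuous Φ) {C : ℝ}
    (hC : ∀ z, ‖Φ z‖ ≤ C * ((1 + ‖z‖ ^ 2) ^ 2)⁻¹) :
    ∫ θ in Set.Ico 0 (2 * Real.pi), ∫ ρ : ℝ, ((|ρ| : ℝ) : ℂ) * Φ (ρ * Complex.exp (θ * Complex.I))
      = 2 * ∫ z, Φ z := by
  have hC0 : 0 ≤ C := by
    have := (norm_nonneg _).trans (hC 0)
    simpa using this
  set K : ℝ → ℝ → ℂ := fun θ ρ => ((|ρ| : ℝ) : ℂ) * Φ (ρ * Complex.exp (θ * Complex.I)) with hK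
  have hKc : Continuous fun p : ℝ × ℝ => K p.1 p.2 := by
    fun_prop
  have hKb : ∀ θ ρ, ‖K θ ρ‖ ≤ C * (1 + ρ ^ 2)⁻¹ := by
    intro θ ρ
    rw [hK]
    simp only [norm_mul, Complex.norm_real, Real.norm_eq_abs, abs_abs]
    have h1 := hC (ρ * Complex.exp (θ * Complex.I))
    rw [norm_ofReal_mul_exp, sq_abs] at h1
    have h2 := abs_mul_inv_sq_le ρ
    calc |ρ| * ‖Φ (ρ * Complex.exp (θ * Complex.I))‖ ≤ |ρ| * (C * ((1 + ρ ^ 2) ^ 2)⁻¹) := by gcongr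
      _ = C * (|ρ| * ((1 + ρ ^ 2) ^ 2)⁻¹) := by ring
      _ ≤ _ := by gcongr
  have hbi : Integrable fun ρ : ℝ => C * (1 + ρ ^ 2)⁻¹ := integrable_inv_one_add_sq.const_mul C
  have hKi : ∀ θ, Integrable (K θ) := fun θ =>
    hbi.mono' (Continuous.aestronglyMeasurable (by fun_prop)) (ae_of_all _ (hKb θ))
  set A : ℝ → ℂ := fun θ => ∫ ρ in Set.Ioi (0 : ℝ), K θ ρ with hA
  have hAc : Continuous A := by
    refine continuous_of_dominated (fun θ => (hKi θ).1.restrict)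
      (fun θ => ae_of_all _ (hKb θ)) hbi.restrict (ae_of_all _ fun ρ => by fun_prop)
  have hper : Function.Periodic A (2 * Real.pi) := by
    intro θ
    simp only [hA, hK]
    congr 1 with ρ
    congr 3
    push_cast
    rw [add_mul, Complex.exp_periodic]
  have hsplit : ∀ θ, ∫ ρ : ℝ, K θ ρ = A θ + A (θ + Real.pi) := by
    intro θ
    rw [← integral_add_compl (measurableSet_Ioi (a := (0 : ℝ))) (hKi θ), Set.compl_Ioi]
    congr 1
    have := integral_comp_neg_Ioi 0 (K θ)
    rw [neg_zero] at this
    rw [← this]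
    simp only [hA, hK]
    congr 1 with ρ
    rw [abs_neg]
    congr 2
    push_cast
    rw [add_mul, Complex.exp_add, Complex.exp_pi_mul_I]
    ring
  have hint : ∀ s : ℝ, ∫ θ in s..s + 2 * Real.pi, A θ = ∫ z, Φ z := by
    intro s
    rw [hper.intervalIntegral_add_eq s (-Real.pi), ← Complex.integral_comp_polarCoord_symm,
      polarCoord_target, Measure.volume_eq_prod, ← Measure.prod_restrict, integral_prod_symm]
    · rw [show -Real.pi + 2 * Real.pi = Real.pi by ring,
        intervalIntegral.integral_of_le (by linarith [Real.pi_pos]), integral_Ioc_eq_integral_Ioo]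
      congr 1 with θ
      refine setIntegral_congr_fun measurableSet_Ioi fun ρ hρ => ?_
      simp only [hK]
      rw [abs_of_pos hρ, Complex.polarCoord_symm_apply, Complex.exp_mul_I]
      simp
    · refine (hbi.restrict.mul_prod (integrable_const (1 : ℝ))).mono' ?_ ?_
      · apply Continuous.aestronglyMeasurable
        simp only [Complex.polarCoord_symm_apply]
        fun_prop
      · rw [Measure.prod_restrict]
        refine (ae_restrict_iff' (measurableSet_Ioi.prod measurableSet_Ioo)).2
          (ae_of_all _ fun p hp => ?_)
        have hp1 : 0 < p.1 := hp.1
        refine le_trans (le_of_eq ?_) ((hKb p.2 p.1).trans (le_of_eq (mul_one _).symm))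
        simp only [hK]
        rw [abs_of_pos hp1, Complex.polarCoord_symm_apply, Complex.exp_mul_I]
        simp
  rw [integral_Ico_eq_integral_Ioc,
    ← intervalIntegral.integral_of_le (by positivity)]
  rw [intervalIntegral.integral_congr (g := fun θ => A θ + A (θ + Real.pi)) fun θ _ => hsplit θ,
    intervalIntegral.integral_add (hAc.intervalIntegrable _ _)
    ((by fun_prop : Continuous fun θ => A (θ + Real.pi)).intervalIntegrable _ _),
    intervalIntegral.integral_comp_add_right A Real.pi, zero_add, add_comm (2 * Real.pi) Real.pi, hint]
  have h0 := hint 0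
  rw [zero_add] at h0
  rw [h0]
  ring

/-- The operator `Λ` applied to the Radon transform of `G`, as the Fourier multiplier
`2 π² |ρ|` along each ray. -/
def filteredRadon (G : SchwartzMap ℂ ℂ) (θ r : ℝ) : ℂ :=
  ∫ ρ : ℝ, ((2 * Real.pi ^ 2 * |ρ| : ℝ) : ℂ) *
    (Complex.exp ((2 * Real.pi * ρ * r : ℝ) * Complex.I) *
      FourierTransform.fourier (⇑G) (ρ * Complex.exp (θ * Complex.I)))

theorem tendsto_principalValue_complexRadon (G : SchwartzMap ℂ ℂ) (θ r : ℝ) :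
    Tendsto (fun ε : ℝ => ∫ x in {x : ℝ | ε < |r - x|},
        ((r - x : ℝ) : ℂ)⁻¹ * deriv (complexRadon G θ) x)
      (𝓝[>] (0 : ℝ)) (𝓝 (filteredRadon G θ r)) := by
  obtain ⟨S, hS⟩ := exists_schwartzMap_eq_complexRadon G θ
  have h := S.tendsto_principalValue_deriv r
  rw [hS] at h
  simpa only [fourier_complexRadon, filteredRadon] using h

theorem exists_norm_abs_mul_fourier_le (G : SchwartzMap ℂ ℂ) :
    ∃ C : ℝ, 0 ≤ C ∧ ∀ θ ρ : ℝ, ‖((2 * Real.pi ^ 2 * |ρ| : ℝ) : ℂ) *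
      FourierTransform.fourier (⇑G) (ρ * Complex.exp (θ * Complex.I))‖ ≤ C * (1 + ρ ^ 2)⁻¹ := by
  obtain ⟨C, hC0, hC⟩ := (FourierTransform.fourier G).exists_norm_le_inv_sq
  refine ⟨2 * Real.pi ^ 2 * C, by positivity, fun θ ρ => ?_⟩
  have h1 := hC (ρ * Complex.exp (θ * Complex.I))
  rw [norm_ofReal_mul_exp, sq_abs, SchwartzMap.fourier_coe] at h1
  have h2 := abs_mul_inv_sq_le ρ
  rw [norm_mul, Complex.norm_real, Real.norm_of_nonneg (by positivity)]
  calc _ ≤ 2 * Real.pi ^ 2 * |ρ| * (C * ((1 + ρ ^ 2) ^ 2)⁻¹) := by gcongr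
    _ = 2 * Real.pi ^ 2 * C * (|ρ| * ((1 + ρ ^ 2) ^ 2)⁻¹) := by ring
    _ ≤ _ := by gcongr

theorem continuous_fourier (G : SchwartzMap ℂ ℂ) :
    Continuous (FourierTransform.fourier (⇑G)) := by
  rw [← SchwartzMap.fourier_coe]
  exact SchwartzMap.continuous _

theorem stronglyMeasurable_filteredRadon (G : SchwartzMap ℂ ℂ) :
    StronglyMeasurable fun p : ℝ × ℝ => filteredRadon G p.1 p.2 := by
  refine StronglyMeasurable.integral_prod_right (f := fun (p : ℝ × ℝ) (ρ : ℝ) =>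
    ((2 * Real.pi ^ 2 * |ρ| : ℝ) : ℂ) *
    (Complex.exp ((2 * Real.pi * ρ * p.2 : ℝ) * Complex.I) *
      FourierTransform.fourier (⇑G) (ρ * Complex.exp (p.1 * Complex.I))))
    (Continuous.stronglyMeasurable ?_)
  have := continuous_fourier G
  simp only [Function.uncurry_def]
  fun_prop

theorem exists_norm_filteredRadon_le (G : SchwartzMap ℂ ℂ) :
    ∃ C : ℝ, 0 ≤ C ∧ ∀ θ r, ‖filteredRadon G θ r‖ ≤ C := by
  obtain ⟨C, hC0, hC⟩ := exists_norm_abs_mul_fourier_le G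
  refine ⟨∫ ρ : ℝ, C * (1 + ρ ^ 2)⁻¹, integral_nonneg fun ρ => by positivity, fun θ r => ?_⟩
  refine norm_integral_le_of_norm_le (integrable_inv_one_add_sq.const_mul C)
    (ae_of_all _ fun ρ => le_trans (le_of_eq ?_) (hC θ ρ))
  rw [norm_mul, norm_mul, norm_mul, Complex.norm_exp_ofReal_mul_I, one_mul]

theorem integral_conj_complexRadon_mul_filteredRadon (F G : SchwartzMap ℂ ℂ) (θ : ℝ) :
    ∫ r : ℝ, starRingEnd ℂ (complexRadon F θ r) * filteredRadon G θ r
      = 2 * Real.pi ^ 2 * ∫ ρ : ℝ, ((|ρ| : ℝ) : ℂ) *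
        (starRingEnd ℂ (FourierTransform.fourier (⇑F) (ρ * Complex.exp (θ * Complex.I))) *
          FourierTransform.fourier (⇑G) (ρ * Complex.exp (θ * Complex.I))) := by
  obtain ⟨C, hC0, hC⟩ := exists_norm_abs_mul_fourier_le G
  have hG := continuous_fourier G
  have hF := continuous_complexRadon F θ
  simp only [filteredRadon, ← integral_const_mul]
  rw [integral_integral_swap]
  · congr 1 with ρ
    rw [← fourier_complexRadon F, Real.fourier_eq' (complexRadon F θ), ← integral_conj, ← integral_mul_const,
      ← integral_const_mul, ← integral_const_mul]
    congr 1 with r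
    have h1 : starRingEnd ℂ (Complex.exp ((-2 * Real.pi * inner ℝ r ρ : ℝ) * Complex.I))
        = Complex.exp ((2 * Real.pi * ρ * r : ℝ) * Complex.I) := by
      rw [← Complex.exp_conj, map_mul, Complex.conj_ofReal, Complex.conj_I]
      congr 1
      simp
      ring
    rw [smul_eq_mul, map_mul, h1]
    push_cast
    ring
  · refine ((integrable_complexRadon F θ).norm.mul_prod
      (integrable_inv_one_add_sq.const_mul C)).mono' ?_ (ae_of_all _ fun p => ?_)
    · apply Continuous.aestronglyMeasurable
      have := hF.star
      simp only [Function.uncurry_def, starRingEnd_apply]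
      fun_prop
    · have := hC θ p.2
      simp only [Function.uncurry]
      rw [norm_mul, RCLike.norm_conj]
      gcongr
      refine le_trans (le_of_eq ?_) this
      rw [norm_mul, norm_mul, norm_mul, Complex.norm_exp_ofReal_mul_I, one_mul]

theorem integral_conj_mul_eq_integral_complexRadon (F G : SchwartzMap ℂ ℂ) :
    ∫ z, starRingEnd ℂ (F z) * G z = (1 / (4 * Real.pi ^ 2) : ℂ) *
      ∫ r : ℝ, ∫ θ in Set.Ico 0 (2 * Real.pi),
        starRingEnd ℂ (complexRadon F θ r) * filteredRadon G θ r := by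
  obtain ⟨C, hC0, hC⟩ := exists_norm_complexRadon_le F
  obtain ⟨D, hD0, hD⟩ := exists_norm_filteredRadon_le G
  have hF := continuous_fourier F
  have hG := continuous_fourier G
  have hplancherel : ∫ z, starRingEnd ℂ (F z) * G z
      = ∫ z, starRingEnd ℂ (FourierTransform.fourier (⇑F) z) * FourierTransform.fourier (⇑G) z := by
    have := SchwartzMap.integral_inner_fourier_fourier F G
    simp only [RCLike.inner_apply, SchwartzMap.fourier_coe] at this
    simpa only [mul_comm] using this.symm
  have hswap : ∫ r : ℝ, ∫ θ in Set.Ico 0 (2 * Real.pi),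
        starRingEnd ℂ (complexRadon F θ r) * filteredRadon G θ r
      = ∫ θ in Set.Ico 0 (2 * Real.pi), ∫ r : ℝ,
        starRingEnd ℂ (complexRadon F θ r) * filteredRadon G θ r := by
    refine integral_integral_swap ?_
    refine ((integrable_inv_one_add_sq.const_mul C).mul_prod (integrable_const D)).mono' ?_
      (ae_of_all _ fun p => ?_)
    · have h1 := (stronglyMeasurable_complexRadon F).measurable.comp measurable_swap
      have h2 := (stronglyMeasurable_filteredRadon G).measurable.comp measurable_swap
      exact ((Complex.continuous_conj.measurable.comp h1).mul h2).aestronglyMeasurable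
    · simp only [Function.uncurry]
      rw [norm_mul, RCLike.norm_conj]
      gcongr
      · exact hC _ _
      · exact hD _ _
  obtain ⟨A, hA0, hA⟩ := (FourierTransform.fourier F).exists_norm_le_inv_sq
  obtain ⟨B, hB0, hB⟩ := (FourierTransform.fourier G).exists_norm_le_inv_sq
  rw [SchwartzMap.fourier_coe] at hA hB
  have hpolar := integral_Ico_integral_abs_mul_polar (C := A * B)
    (Φ := fun z => starRingEnd ℂ (FourierTransform.fourier (⇑F) z) *
      FourierTransform.fourier (⇑G) z) (by
        have := hF.star
        simp only [starRingEnd_apply]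
        fun_prop) (fun z => by
        rw [norm_mul, RCLike.norm_conj]
        calc _ ≤ (A * ((1 + ‖z‖ ^ 2) ^ 2)⁻¹) * (B * 1) := by
              refine mul_le_mul (hA z) ((hB z).trans ?_) (norm_nonneg _) (by positivity)
              gcongr
              refine inv_le_one_of_one_le₀ (one_le_pow₀ ?_)
              nlinarith [sq_nonneg ‖z‖]
          _ = _ := by ring)
  simp only [hswap, integral_conj_complexRadon_mul_filteredRadon]
  rw [integral_const_mul, hpolar, hplancherel]
  have hpi : (Real.pi : ℂ) ≠ 0 := Complex.ofReal_ne_zero.2 Real.pi_ne_zero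
  field_simp
  ring

theorem radonT_eq_complexRadon (f : ℝ × ℝ → ℂ) (F : ℂ → ℂ) (hF : ∀ z, F z = f (z.re, z.im))
    (θ r : ℝ) : radonT f θ r = complexRadon F θ r := by
  simp only [radonT, complexRadon, hF]
  congr 1 with t
  congr 2 <;> simp [Complex.exp_ofReal_mul_I_re, Complex.exp_ofReal_mul_I_im]

/-- Plancherel formula for the Radon transform: for Schwartz functions `f, g` on `ℝ²`,
`∫∫ conj(f)·g = (1/4π²) ∫_ℝ ∫₀^{2π} conj((Rf)(θ,r))·(ΛRg)(θ,r) dθ dr`, where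
`(Λφ)(θ,r) = pv ∫ (1/(r-x))·∂φ(θ,x)/∂x dx`; in particular all the principal value
limits defining `ΛRg` exist. -/
theorem radon_plancherel (f g : SchwartzMap (ℝ × ℝ) ℂ) :
    ∃ Λg : ℝ → ℝ → ℂ,
      (∀ θ r : ℝ,
        Tendsto
          (fun ε : ℝ => ∫ x in {x : ℝ | ε < |r - x|},
            ((r - x : ℝ) : ℂ)⁻¹ * deriv (fun x' => radonT (⇑g) θ x') x)
          (𝓝[>] (0:ℝ)) (𝓝 (Λg θ r))) ∧
      (∫ p : ℝ × ℝ, starRingEnd ℂ (f p) * g p) =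
        (1 / (4 * Real.pi ^ 2) : ℂ) *
          ∫ r : ℝ, ∫ θ in Set.Ico 0 (2 * Real.pi),
            starRingEnd ℂ (radonT (⇑f) θ r) * Λg θ r := by
  let F : SchwartzMap ℂ ℂ :=
    SchwartzMap.compCLMOfContinuousLinearEquiv ℂ Complex.equivRealProdCLM f
  let G : SchwartzMap ℂ ℂ :=
    SchwartzMap.compCLMOfContinuousLinearEquiv ℂ Complex.equivRealProdCLM g
  have hF : ∀ z, F z = f (z.re, z.im) := fun z => rfl
  have hG : ∀ z, G z = g (z.re, z.im) := fun z => rfl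
  have hf : radonT f = complexRadon F := by
    ext θ r
    exact radonT_eq_complexRadon f F hF θ r
  have hg : radonT g = complexRadon G := by
    ext θ r
    exact radonT_eq_complexRadon g G hG θ r
  refine ⟨filteredRadon G, fun θ r => ?_, ?_⟩
  · rw [hg]
    exact tendsto_principalValue_complexRadon G θ r
  · rw [hf, ← integral_conj_mul_eq_integral_complexRadon,
      ← Complex.volume_preserving_equiv_real_prod.integral_comp
        Complex.measurableEquivRealProd.measurableEmbedding]
    rfl

end
end

section
/- For every p ∈ ℕ and every r ∈ ℝ, the 2p-th derivative of Y satisfies Y^{(2p)}(r) = (−1)^p · 2^p · Σ_{k=0}^∞ [(−1)^k (k+p)! / (2^k (2k)!)] · H_{2k}(r), the series converging for all r. -/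
open MeasureTheory Filter Topology

noncomputable section

/-- The Taylor coefficients (times `n!`) of `t ↦ exp (b * t + c * t ^ 2)` at `0`. -/
def quadExpCoeff (b c : ℝ) : ℕ → ℝ
  | 0 => 1
  | 1 => b
  | (n + 2) => b * quadExpCoeff b c (n + 1) + 2 * c * (n + 1) * quadExpCoeff b c n

lemma hermiteH_eq_quadExpCoeff (r : ℝ) (n : ℕ) : hermiteH n r = quadExpCoeff (2 * r) (-1) n := by
  induction n using Nat.twoStepInduction with
  | zero => rfl
  | one => rfl
  | more n h₀ h₁ =>
    simp only [hermiteH, quadExpCoeff, h₀, h₁]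
    ring

lemma abs_quadExpCoeff_le (b c : ℝ) (n : ℕ) :
    |quadExpCoeff b c n| ≤ quadExpCoeff |b| |c| n := by
  induction n using Nat.twoStepInduction with
  | zero => simp [quadExpCoeff]
  | one => simp [quadExpCoeff]
  | more n h₀ h₁ =>
    simp only [quadExpCoeff]
    refine (abs_add_le _ _).trans ?_
    have hn : |(n : ℝ) + 1| = n + 1 := abs_of_nonneg (by positivity)
    simp only [abs_mul, hn, abs_two]
    gcongr

lemma contDiff_quadExp (b c : ℂ) {n : WithTop ℕ∞} :
    ContDiff ℂ n fun t : ℂ => Complex.exp (b * t + c * t ^ 2) := by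
  fun_prop

lemma iteratedDeriv_quadExp_one (b c : ℂ) :
    iteratedDeriv 1 (fun t : ℂ => Complex.exp (b * t + c * t ^ 2)) =
      fun t => (b + 2 * c * t) * Complex.exp (b * t + c * t ^ 2) := by
  rw [iteratedDeriv_one]
  funext t
  have h : HasDerivAt (fun t : ℂ => b * t + c * t ^ 2) (b * 1 + c * (2 * t)) t := by
    exact (((hasDerivAt_id t).const_mul b).add (((hasDerivAt_id t).pow 2).const_mul c)).congr_deriv
      (by simp)
  rw [h.cexp.deriv]
  ring

lemma iteratedDeriv_quadExp_add_two (b c : ℂ) (n : ℕ) :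
    iteratedDeriv (n + 2) (fun t : ℂ => Complex.exp (b * t + c * t ^ 2)) =
      fun t => (b + 2 * c * t) *
          iteratedDeriv (n + 1) (fun t : ℂ => Complex.exp (b * t + c * t ^ 2)) t +
        2 * c * (n + 1) * iteratedDeriv n (fun t : ℂ => Complex.exp (b * t + c * t ^ 2)) t := by
  set f : ℂ → ℂ := fun t => Complex.exp (b * t + c * t ^ 2) with hf
  have hd (m : ℕ) (t : ℂ) : HasDerivAt (iteratedDeriv m f) (iteratedDeriv (m + 1) f t) t := by
    rw [iteratedDeriv_succ]
    have hdiff : Differentiable ℂ (iteratedDeriv m f) :=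
      (contDiff_quadExp b c (n := ⊤)).differentiable_iteratedDeriv m (by simp)
    exact (hdiff t).hasDerivAt
  have hl (t : ℂ) : HasDerivAt (fun t : ℂ => b + 2 * c * t) (2 * c) t := by
    simpa using ((hasDerivAt_id t).const_mul (2 * c)).const_add b
  induction n with
  | zero =>
    funext t
    have h := (hl t).mul (hd 0 t)
    rw [iteratedDeriv_zero, hf] at h
    have h' := hd 1 t
    rw [iteratedDeriv_quadExp_one] at h'
    rw [h'.unique h]
    simp
    ring
  | succ n ih =>
    funext t
    have h := ((hl t).mul (hd (n + 1) t)).add ((hd n t).const_mul (2 * c * (n + 1)))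
    have h' := hd (n + 2) t
    rw [ih] at h'
    rw [h'.unique h]
    push_cast
    ring

lemma hasSum_quadExpCoeff (b c : ℝ) (t : ℂ) :
    HasSum (fun n : ℕ => (quadExpCoeff b c n : ℂ) * t ^ n / (n.factorial : ℂ))
      (Complex.exp (b * t + c * t ^ 2)) := by
  have key (n : ℕ) : iteratedDeriv n (fun t : ℂ => Complex.exp (b * t + c * t ^ 2)) 0 =
      quadExpCoeff b c n := by
    induction n using Nat.twoStepInduction with
    | zero => simp [quadExpCoeff]
    | one =>
      rw [iteratedDeriv_quadExp_one]
      simp [quadExpCoeff]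
    | more n h₀ h₁ =>
      rw [iteratedDeriv_quadExp_add_two]
      beta_reduce
      rw [h₀, h₁]
      simp [quadExpCoeff]
  have h := Complex.hasSum_taylorSeries_of_entire
    ((contDiff_quadExp b c (n := 1)).differentiable one_ne_zero) 0 t
  refine h.congr_fun fun n => ?_
  rw [key]
  simp only [sub_zero, smul_eq_mul]
  ring

lemma hasSum_quadExpCoeff_real (b c t : ℝ) :
    HasSum (fun n : ℕ => quadExpCoeff b c n * t ^ n / n.factorial)
      (Real.exp (b * t + c * t ^ 2)) := by
  have h := hasSum_quadExpCoeff b c t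
  exact_mod_cast h

lemma integrableOn_pow_mul_exp_quadratic {b : ℝ} (hb : 0 < b) (a : ℝ) (n : ℕ) :
    IntegrableOn (fun x : ℝ => x ^ n * Real.exp (a * x - b * x ^ 2)) (Set.Ioi 0) := by
  have h : IntegrableOn (fun x : ℝ => x ^ (n : ℝ) * Real.exp (-(b / 2) * x ^ 2)) (Set.Ioi 0) :=
    integrableOn_rpow_mul_exp_neg_mul_sq (half_pos hb) (by have := n.cast_nonneg (α := ℝ); linarith)
  refine Integrable.mono' (h.const_mul (Real.exp (a ^ 2 / (2 * b))))
    (Continuous.aestronglyMeasurable (by fun_prop)) ?_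
  filter_upwards [ae_restrict_mem measurableSet_Ioi] with x hx
  have hx : 0 < x := hx
  rw [Real.norm_of_nonneg (by positivity), Real.rpow_natCast, mul_left_comm, ← Real.exp_add]
  gcongr
  have : a ^ 2 / (2 * b) + -(b / 2) * x ^ 2 - (a * x - b * x ^ 2) =
      (a - b * x) ^ 2 / (2 * b) := by
    field_simp
    ring
  have : 0 ≤ (a - b * x) ^ 2 / (2 * b) := by positivity
  linarith

lemma integral_pow_odd_mul_exp_neg_half_sq (j : ℕ) :
    ∫ x in Set.Ioi (0 : ℝ), x ^ (2 * j + 1) * Real.exp (-x ^ 2 / 2) =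
      2 ^ j * (j.factorial : ℝ) := by
  have h := integral_rpow_mul_exp_neg_mul_rpow (p := 2) (q := ((2 * j + 1 : ℕ) : ℝ)) (b := 1 / 2)
    two_pos (by have := (2 * j + 1).cast_nonneg (α := ℝ); linarith) (by norm_num)
  have e : (((2 * j + 1 : ℕ) : ℝ) + 1) / 2 = j + 1 := by push_cast; ring
  rw [neg_div, e, Real.Gamma_nat_eq_factorial, one_div, Real.inv_rpow two_pos.le,
    Real.rpow_neg two_pos.le, inv_inv] at h
  have e₂ : (2 : ℝ) ^ ((j : ℝ) + 1) = 2 ^ (j + 1) := by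
    rw [← Real.rpow_natCast]; push_cast; rfl
  rw [e₂] at h
  calc _ = _ := by
        refine integral_congr_ae (Eventually.of_forall fun x => ?_)
        simp only [Real.rpow_natCast, Real.rpow_two]
        ring_nf
    _ = _ := h
    _ = _ := by ring

/-- The one-sided Fourier transform of `x ^ n * exp (-x ^ 2 / 4)`. -/
def halfGaussFourier (n : ℕ) (r : ℝ) : ℂ :=
  ∫ x in Set.Ioi (0 : ℝ), (x : ℂ) ^ n * Complex.exp (Complex.I * r * x - x ^ 2 / 4)

lemma norm_cexp_I_mul_sub_sq (r x : ℝ) :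
    ‖Complex.exp (Complex.I * r * x - x ^ 2 / 4)‖ = Real.exp (-(x ^ 2 / 4)) := by
  have : Complex.I * r * x - (x : ℂ) ^ 2 / 4 =
      ((-(x ^ 2 / 4) : ℝ) : ℂ) + ((r * x : ℝ) : ℂ) * Complex.I := by
    push_cast; ring
  rw [this, Complex.exp_add, norm_mul, Complex.norm_exp_ofReal_mul_I, mul_one,
    Complex.norm_exp_ofReal]

lemma integrableOn_pow_mul_exp_neg_sq_div_four (n : ℕ) :
    IntegrableOn (fun x : ℝ => x ^ n * Real.exp (-(x ^ 2 / 4))) (Set.Ioi 0) := by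
  convert integrableOn_pow_mul_exp_quadratic (b := 1 / 4) (by norm_num) 0 n using 4
  ring

lemma norm_pow_mul_cexp {x : ℝ} (hx : 0 < x) (n : ℕ) (r : ℝ) :
    ‖(x : ℂ) ^ n * Complex.exp (Complex.I * r * x - x ^ 2 / 4)‖ =
      x ^ n * Real.exp (-(x ^ 2 / 4)) := by
  rw [norm_mul, norm_cexp_I_mul_sub_sq, norm_pow, Complex.norm_real, Real.norm_of_nonneg hx.le]

lemma integrableOn_halfGaussFourier (n : ℕ) (r : ℝ) :
    IntegrableOn (fun x : ℝ => (x : ℂ) ^ n * Complex.exp (Complex.I * r * x - x ^ 2 / 4))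
      (Set.Ioi 0) := by
  refine Integrable.mono' (integrableOn_pow_mul_exp_neg_sq_div_four n)
    (Continuous.aestronglyMeasurable (by fun_prop)) ?_
  filter_upwards [ae_restrict_mem measurableSet_Ioi] with x hx
  exact (norm_pow_mul_cexp hx n r).le

lemma hasDerivAt_halfGaussFourier (n : ℕ) (r : ℝ) :
    HasDerivAt (halfGaussFourier n) (Complex.I * halfGaussFourier (n + 1) r) r := by
  have h := hasDerivAt_integral_of_dominated_loc_of_deriv_le (μ := volume.restrict (Set.Ioi 0))
    (F := fun r x : ℝ => (x : ℂ) ^ n * Complex.exp (Complex.I * r * x - x ^ 2 / 4))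
    (F' := fun r x : ℝ =>
      Complex.I * ((x : ℂ) ^ (n + 1) * Complex.exp (Complex.I * r * x - x ^ 2 / 4)))
    (bound := fun x => x ^ (n + 1) * Real.exp (-(x ^ 2 / 4))) (x₀ := r) (s := Set.univ)
    univ_mem (Eventually.of_forall fun r => Continuous.aestronglyMeasurable (by fun_prop))
    (integrableOn_halfGaussFourier n r) (Continuous.aestronglyMeasurable (by fun_prop))
    ?_ (integrableOn_pow_mul_exp_neg_sq_div_four (n + 1)) ?_
  · have h := h.2
    rw [integral_const_mul] at h
    exact h
  · filter_upwards [ae_restrict_mem measurableSet_Ioi] with x hx r _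
    rw [norm_mul, Complex.norm_I, one_mul]
    exact (norm_pow_mul_cexp hx (n + 1) r).le
  · refine Eventually.of_forall fun x r _ => ?_
    have h : HasDerivAt (fun r : ℝ => Complex.I * (r : ℂ) * x - (x : ℂ) ^ 2 / 4)
        (Complex.I * 1 * x) r :=
      (((Complex.ofRealCLM.hasDerivAt (x := r)).const_mul Complex.I).mul_const (x : ℂ)).sub_const _
    exact (h.cexp.const_mul ((x : ℂ) ^ n)).congr_deriv (by ring)

lemma iteratedDeriv_halfGaussFourier_re (m n : ℕ) :
    iteratedDeriv m (fun r => (halfGaussFourier n r).re) =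
      fun r => (Complex.I ^ m * halfGaussFourier (n + m) r).re := by
  induction m with
  | zero => simp
  | succ m ih =>
    rw [iteratedDeriv_succ, ih]
    funext r
    have h := (hasDerivAt_halfGaussFourier (n + m) r).const_mul (Complex.I ^ m)
    refine (Complex.reCLM.hasFDerivAt.comp_hasDerivAt r h).deriv.trans ?_
    rw [Complex.reCLM_apply, pow_succ, mul_assoc, add_assoc]

lemma halfGaussFourier_one (r : ℝ) :
    halfGaussFourier 1 r = 2 + 2 * Complex.I * r * halfGaussFourier 0 r := by
  have hd (x : ℝ) : HasDerivAt
      (fun x : ℝ => -2 * Complex.exp (Complex.I * r * x - (x : ℂ) ^ 2 / 4))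
      ((x : ℂ) ^ 1 * Complex.exp (Complex.I * r * x - (x : ℂ) ^ 2 / 4) -
        2 * Complex.I * r *
          ((x : ℂ) ^ 0 * Complex.exp (Complex.I * r * x - (x : ℂ) ^ 2 / 4))) x := by
    have hx : HasDerivAt (fun x : ℝ => (x : ℂ)) 1 x := Complex.ofRealCLM.hasDerivAt
    have h := (hx.const_mul (Complex.I * r)).sub ((hx.pow 2).div_const 4)
    refine (h.cexp.const_mul (-2)).congr_deriv ?_
    simp
    ring
  have hint := (integrableOn_halfGaussFourier 1 r).sub
    ((integrableOn_halfGaussFourier 0 r).const_mul (2 * Complex.I * r))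
  have hlim : Tendsto (fun x : ℝ => -2 * Complex.exp (Complex.I * r * x - (x : ℂ) ^ 2 / 4))
      atTop (𝓝 0) := by
    rw [tendsto_zero_iff_norm_tendsto_zero]
    simp only [norm_mul, norm_cexp_I_mul_sub_sq]
    have h : Tendsto (fun x : ℝ => Real.exp (-(x ^ 2 / 4))) atTop (𝓝 0) :=
      Real.tendsto_exp_neg_atTop_nhds_zero.comp
        ((tendsto_pow_atTop two_ne_zero).atTop_div_const (by norm_num))
    simpa using h.const_mul ‖(-2 : ℂ)‖
  have h := integral_Ioi_of_hasDerivAt_of_tendsto' (a := 0) (fun x _ => hd x) hint hlim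
  rw [integral_sub (integrableOn_halfGaussFourier 1 r)
    ((integrableOn_halfGaussFourier 0 r).const_mul (2 * Complex.I * r)), integral_const_mul] at h
  change halfGaussFourier 1 r - 2 * Complex.I * r * halfGaussFourier 0 r = _ at h
  rw [sub_eq_iff_eq_add] at h
  simpa using h

lemma halfGaussFourier_one_re (r : ℝ) :
    (halfGaussFourier 1 r).re = 2 - 2 * r * (halfGaussFourier 0 r).im := by
  rw [halfGaussFourier_one]
  simp
  ring

lemma halfGaussFourier_zero_zero_im : (halfGaussFourier 0 0).im = 0 := by
  have : halfGaussFourier 0 0 =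
      ((∫ x in Set.Ioi (0 : ℝ), Real.exp (-(x ^ 2 / 4)) : ℝ) : ℂ) := by
    rw [← integral_complex_ofReal]
    simp [halfGaussFourier]
  rw [this, Complex.ofReal_im]

lemma daw_eq_halfGaussFourier (r : ℝ) : daw r = (halfGaussFourier 0 r).im / 2 := by
  have hd (r : ℝ) : HasDerivAt (fun r => Real.exp (r ^ 2) * ((halfGaussFourier 0 r).im / 2))
      (Real.exp (r ^ 2)) r := by
    have h := (Complex.imCLM.hasFDerivAt.comp_hasDerivAt r
      (hasDerivAt_halfGaussFourier 0 r)).div_const 2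
    have he : HasDerivAt (fun r : ℝ => Real.exp (r ^ 2)) _ r := (hasDerivAt_pow 2 r).exp
    refine (he.mul h).congr_deriv ?_
    simp [halfGaussFourier_one_re]
    ring
  have h := intervalIntegral.integral_eq_sub_of_hasDerivAt (a := 0) (b := r) (fun x _ => hd x)
    (Continuous.intervalIntegrable (by fun_prop) _ _)
  rw [daw, h, halfGaussFourier_zero_zero_im, zero_div, mul_zero, sub_zero, ← mul_assoc,
    ← Real.exp_add]
  simp

lemma Yf_eq_halfGaussFourier : Yf = fun r => (halfGaussFourier 1 r).re := by
  funext r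
  rw [Yf, daw_eq_halfGaussFourier, halfGaussFourier_one_re]
  ring

lemma hasSum_halfGaussFourier (m : ℕ) (r : ℝ) :
    HasSum (fun n : ℕ => (Complex.I / 2) ^ n *
        ((hermiteH n r / n.factorial *
          ∫ x in Set.Ioi (0 : ℝ), x ^ (m + n) * Real.exp (-x ^ 2 / 2) : ℝ) : ℂ))
      (halfGaussFourier m r) := by
  have hmaj (x : ℝ) := (hasSum_quadExpCoeff_real |2 * r| |-1| (x / 2)).mul_left
    (x ^ m * Real.exp (-x ^ 2 / 2))
  have h := hasSum_integral_of_dominated_convergence (μ := volume.restrict (Set.Ioi (0 : ℝ)))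
    (F := fun (n : ℕ) (x : ℝ) => ((x ^ m * Real.exp (-x ^ 2 / 2) : ℝ) : ℂ) *
      ((quadExpCoeff (2 * r) (-1) n : ℂ) * (Complex.I * x / 2) ^ n / (n.factorial : ℂ)))
    (f := fun x : ℝ => (x : ℂ) ^ m * Complex.exp (Complex.I * r * x - x ^ 2 / 4))
    (fun (n : ℕ) (x : ℝ) => x ^ m * Real.exp (-x ^ 2 / 2) *
      (quadExpCoeff |2 * r| |-1| n * (x / 2) ^ n / n.factorial))
    (fun n => Continuous.aestronglyMeasurable (by fun_prop)) ?_
    (Eventually.of_forall fun x => (hmaj x).summable) ?_ (Eventually.of_forall fun x => ?_)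
  · refine h.congr_fun fun n => ?_
    rw [hermiteH_eq_quadExpCoeff, ← integral_const_mul, ← integral_complex_ofReal,
      ← integral_const_mul]
    refine integral_congr_ae (Eventually.of_forall fun x => ?_)
    push_cast
    simp only [pow_add, mul_pow, div_pow]
    ring
  · intro n
    filter_upwards [ae_restrict_mem measurableSet_Ioi] with x hx
    have hx : 0 < x := hx
    rw [norm_mul, Complex.norm_real, Real.norm_of_nonneg (by positivity)]
    simp only [norm_mul, norm_div, norm_pow, Complex.norm_I, one_mul, Complex.norm_real,
      Complex.norm_natCast, Complex.norm_ofNat, Real.norm_of_nonneg hx.le]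
    gcongr
    exact abs_quadExpCoeff_le _ _ n
  · simp only [fun x => (hmaj x).tsum_eq]
    refine (integrableOn_pow_mul_exp_quadratic (b := 1 / 4) (by norm_num) |r| m).congr
      (Eventually.of_forall fun x => ?_)
    beta_reduce
    rw [mul_assoc, ← Real.exp_add, abs_mul]
    congr 2
    simp only [abs_two, abs_neg, abs_one]
    ring
  · convert! (hasSum_quadExpCoeff (2 * r) (-1) (Complex.I * x / 2)).mul_left
      ((x ^ m * Real.exp (-x ^ 2 / 2) : ℝ) : ℂ) using 1
    push_cast
    rw [mul_assoc (_ ^ m), ← Complex.exp_add]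
    congr 2
    rw [div_pow, mul_pow, Complex.I_sq]
    ring

/-- For all `p ∈ ℕ` and `r ∈ ℝ`:
`Y^{(2p)}(r) = (-1)^p 2^p Σ_{k=0}^∞ (-1)^k (k+p)!/(2^k (2k)!) H_{2k}(r)`,
the series converging for all `r`. -/
theorem Yf_even_deriv_hermite_series (p : ℕ) (r : ℝ) :
    HasSum
      (fun k : ℕ =>
        (-1 : ℝ) ^ p * 2 ^ p *
          ((-1 : ℝ) ^ k * ((k + p).factorial : ℝ) / (2 ^ k * ((2 * k).factorial : ℝ))) *
          hermiteH (2 * k) r)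
      (iteratedDeriv (2 * p) Yf r) := by
  have h := Complex.hasSum_re ((hasSum_halfGaussFourier (1 + 2 * p) r).mul_left
    (Complex.I ^ (2 * p)))
  rw [Yf_eq_halfGaussFourier, iteratedDeriv_halfGaussFourier_re]
  have hinj : Function.Injective fun k : ℕ => 2 * k := mul_right_injective₀ two_ne_zero
  rw [← hinj.hasSum_iff] at h
  · refine h.congr_fun fun k => ?_
    have hpow : Complex.I ^ (2 * p) * (Complex.I / 2) ^ (2 * k) =
        (((-1) ^ p * ((-1) ^ k / 4 ^ k) : ℝ) : ℂ) := by
      rw [pow_mul, pow_mul, div_pow, Complex.I_sq, div_pow]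
      norm_num
    simp only [Function.comp_apply]
    rw [← mul_assoc, hpow, ← Complex.ofReal_mul, Complex.ofReal_re,
      show 1 + 2 * p + 2 * k = 2 * (k + p) + 1 by ring, integral_pow_odd_mul_exp_neg_half_sq,
      show (4 : ℝ) = 2 * 2 by norm_num, mul_pow, pow_add]
    field_simp
  · intro n hn
    obtain ⟨k, rfl⟩ : Odd n := by
      rw [← Nat.not_even_iff_odd]
      rintro ⟨k, rfl⟩
      exact hn ⟨k, two_mul k⟩
    rw [← mul_assoc, Complex.re_mul_ofReal]
    have hpow : Complex.I ^ (2 * p) * (Complex.I / 2) ^ (2 * k + 1) =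
        (((-1) ^ p * ((-1) ^ k / 4 ^ k) / 2 : ℝ) : ℂ) * Complex.I := by
      rw [pow_succ, pow_mul, pow_mul, div_pow, Complex.I_sq, div_pow]
      push_cast
      norm_num
      ring
    rw [hpow, Complex.re_ofReal_mul, Complex.I_re, mul_zero, zero_mul]

end
end
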